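/- arXiv:math/9904107 — 5 statements merged into one kernel-verified Lean document; each statement's English description precedes it below -/
import Mathlib

section
/- For every n ≥ 1 and every k with 0 ≤ k ≤ n−1, the number of 132-avoiding permutations of [n] having exactly k descents equals the Narayana number (1/n)·C(n,k)·C(n,k+1); equivalently, n times the number of 132-avoiding permutations of [n] with exactly k descents equals C(n,k)·C(n,k+1). -/
/-- A permutation `p` of `[n]` (0-based `Fin n`) is 132-avoiding if there are
no positions `a < b < c` with `p a < p c < p b`. -/
def Avoids132 {n : ℕ} (p : Equiv.Perm (Fin n)) : Prop :=
  ∀ a b c : Fin n, a < b → b < c → ¬ (p a < p c ∧ p c < p b)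

/-- The descent set of `p`, as a set of 1-based positions `i ∈ [n-1]`:
`i` is a descent iff `p(i) > p(i+1)`, i.e. (0-based) `p ⟨i-1⟩ > p ⟨i⟩`. -/
def Des {n : ℕ} (p : Equiv.Perm (Fin n)) : Set ℕ :=
  {i | ∃ h : 1 ≤ i ∧ i < n,
        p ⟨i, h.2⟩ < p ⟨i - 1, Nat.lt_of_le_of_lt (Nat.sub_le i 1) h.2⟩}

namespace Nara

/-- prepend the value `D` to the permutation `q`. -/
noncomputable def mk {n : ℕ} (x : Fin (n+1) × Equiv.Perm (Fin n)) : Equiv.Perm (Fin (n+1)) :=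
  Equiv.ofBijective (Fin.cons x.1 (fun i => x.1.succAbove (x.2 i)) : Fin (n+1) → Fin (n+1)) (by
    rw [← Finite.injective_iff_bijective, Fin.cons_injective_iff]
    refine ⟨?_, ?_⟩
    · rintro ⟨i, hi⟩
      exact Fin.succAbove_ne _ _ hi
    · intro i j h
      exact x.2.injective (Fin.succAbove_right_injective h))

lemma mk_zero {n : ℕ} (x : Fin (n+1) × Equiv.Perm (Fin n)) : mk x 0 = x.1 := by
  simp [mk]

lemma mk_succ {n : ℕ} (x : Fin (n+1) × Equiv.Perm (Fin n)) (i : Fin n) :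
    mk x i.succ = x.1.succAbove (x.2 i) := by
  simp [mk]

lemma mk_injective {n : ℕ} : Function.Injective (mk (n := n)) := by
  rintro ⟨a, q⟩ ⟨b, r⟩ h
  have h0 : a = b := by
    have := congrArg (fun p => p 0) h
    simpa [mk_zero] using this
  subst h0
  congr 1
  ext i
  have := congrArg (fun p => p i.succ) h
  simp only [mk_succ] at this
  rw [Fin.succAbove_right_injective this]

lemma mk_bijective {n : ℕ} : Function.Bijective (mk (n := n)) := by
  rw [Fintype.bijective_iff_injective_and_card]
  refine ⟨mk_injective, ?_⟩
  simp [Fintype.card_perm, Nat.factorial_succ]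

/-- number of descents -/
def desF {n : ℕ} (p : Equiv.Perm (Fin (n+1))) : ℕ :=
  (Finset.univ.filter fun i : Fin n => p i.succ < p i.castSucc).card

lemma desF_eq {n : ℕ} (p : Equiv.Perm (Fin (n+1))) : (Des p).ncard = desF p := by
  have : Des p = (fun i : Fin n => i.val + 1) ''
      (↑(Finset.univ.filter fun i : Fin n => p i.succ < p i.castSucc) : Set (Fin n)) := by
    ext i
    simp only [Des, Set.mem_ofPred_eq, Set.mem_image, Finset.coe_filter, Finset.mem_univ, true_and]
    constructor
    · rintro ⟨⟨h1, h2⟩, h⟩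
      obtain ⟨j, rfl⟩ : ∃ j, i = j + 1 := ⟨i - 1, by omega⟩
      exact ⟨⟨j, by omega⟩, h, rfl⟩
    · rintro ⟨j, h, rfl⟩
      exact ⟨⟨by omega, by omega⟩, h⟩
  rw [this, Set.ncard_image_of_injective, Set.ncard_coe_finset]
  · rfl
  · intro a b h
    ext
    simpa using h

lemma succAbove_val {n : ℕ} (D : Fin (n+2)) (x : Fin (n+1)) :
    (D.succAbove x).val = if x.val < D.val then x.val else x.val + 1 := by
  simp only [Fin.succAbove, Fin.lt_def, Fin.val_castSucc]
  split_ifs <;> simp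

lemma desF_mk {n : ℕ} (D : Fin (n+2)) (q : Equiv.Perm (Fin (n+1))) :
    desF (mk (D, q)) = desF q + if (q 0).val < D.val then 1 else 0 := by
  unfold desF
  rw [Finset.card_filter, Finset.card_filter, Fin.sum_univ_succ, add_comm]
  congr 1
  · refine Finset.sum_congr rfl fun i _ => ?_
    rw [← Fin.succ_castSucc, mk_succ, mk_succ]
    simp only [Fin.succAbove_lt_succAbove_iff]
  · rw [mk_succ, Fin.castSucc_zero, mk_zero]
    simp only [Fin.lt_def, succAbove_val]
    split_ifs <;> omega

lemma avoids_mk {n : ℕ} (D : Fin (n+2)) (q : Equiv.Perm (Fin (n+1))) :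
    Avoids132 (mk (D, q)) ↔ Avoids132 q ∧ (q 0).val ≤ D.val := by
  have hval := succAbove_val D
  constructor
  · intro h
    refine ⟨?_, ?_⟩
    · intro a b c hab hbc hh
      refine h a.succ b.succ c.succ (by simpa) (by simpa) ?_
      simpa only [mk_succ, Fin.succAbove_lt_succAbove_iff] using hh
    · by_contra! hlt
      have hDn : D.val < n + 1 := by omega
      obtain ⟨c, hc⟩ := q.surjective ⟨D.val, hDn⟩
      have hc0 : 0 < c := by
        rw [Fin.pos_iff_ne_zero]
        rintro rfl
        rw [hc] at hlt
        simp at hlt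
      refine h 0 (Fin.succ 0) c.succ (Fin.succ_pos _) (Fin.succ_lt_succ_iff.2 hc0) ?_
      rw [mk_succ, mk_succ, mk_zero]
      simp only [Fin.lt_def, hval, hc]
      split_ifs <;> omega
  · rintro ⟨h, hD⟩ a b c hab hbc
    induction b using Fin.cases with
    | zero => exact absurd hab (by simp)
    | succ b =>
    induction c using Fin.cases with
    | zero => exact absurd hbc (by simp)
    | succ c =>
    have hbc' : b < c := by simpa using hbc
    induction a using Fin.cases with
    | succ a =>
      simp only [mk_succ, Fin.succAbove_lt_succAbove_iff]
      exact h a b c (by simpa using hab) hbc'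
    | zero =>
      rw [mk_succ, mk_succ, mk_zero]
      simp only [Fin.succAbove_lt_succAbove_iff]
      rintro ⟨h1, h2⟩
      simp only [Fin.lt_def, hval] at h1
      have h3 : D.val ≤ (q c).val := by split_ifs at h1 <;> omega
      rw [Fin.lt_def] at h2
      have hb0 : 0 < b := by
        rw [Fin.pos_iff_ne_zero]
        rintro rfl
        omega
      refine h 0 b c hb0 hbc' ⟨?_, h2⟩
      have hne : q 0 ≠ q c := fun e => by
        have := q.injective e
        subst this
        exact absurd hbc' (by simp)
      have : (q 0).val ≠ (q c).val := fun e => hne (Fin.ext e)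
      rw [Fin.lt_def]
      omega

open Classical in
/-- count with first value `D` -/
noncomputable def t (n k D : ℕ) : ℕ :=
  (Finset.univ.filter fun p : Equiv.Perm (Fin (n+1)) =>
    Avoids132 p ∧ desF p = k ∧ (p 0).val = D).card

open Classical in
/-- count with first value less than `D` -/
noncomputable def s (n k D : ℕ) : ℕ :=
  (Finset.univ.filter fun p : Equiv.Perm (Fin (n+1)) =>
    Avoids132 p ∧ desF p = k ∧ (p 0).val < D).card

lemma s_zero (n k : ℕ) : s n k 0 = 0 := by simp [s]

lemma s_succ (n k D : ℕ) : s n k (D+1) = s n k D + t n k D := by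
  classical
  unfold s t
  rw [← Finset.card_union_of_disjoint]
  · congr 1
    ext p
    simp only [Finset.mem_filter, Finset.mem_union, Finset.mem_univ, true_and]
    rw [Nat.lt_succ_iff_lt_or_eq]
    tauto
  · rw [Finset.disjoint_filter]
    rintro p - ⟨_, _, h⟩ ⟨_, _, h'⟩
    omega

lemma t_big (n k D : ℕ) (h : n < D) : t n k D = 0 := by
  classical
  unfold t
  rw [Finset.card_eq_zero, Finset.filter_eq_empty_iff]
  rintro p - ⟨_, _, h'⟩
  have := (p 0).isLt
  omega

open Classical in
lemma t_eq (n k D : ℕ) (h : D ≤ n + 1) : t (n+1) k D =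
    (Finset.univ.filter fun q : Equiv.Perm (Fin (n+1)) =>
      (Avoids132 q ∧ (q 0).val ≤ D) ∧ desF q + (if (q 0).val < D then 1 else 0) = k).card := by
  symm
  unfold t
  refine Finset.card_bij (fun q _ => mk (⟨D, by omega⟩, q)) ?_ ?_ ?_
  · intro q hq
    simp only [Finset.mem_filter, Finset.mem_univ, true_and] at hq ⊢
    rw [avoids_mk, desF_mk, mk_zero]
    exact ⟨hq.1, hq.2, rfl⟩
  · intro q _ r _ h
    have := mk_injective h
    simpa using this
  · intro p hp
    obtain ⟨⟨E, q⟩, rfl⟩ := mk_bijective.2 p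
    simp only [Finset.mem_filter, Finset.mem_univ, true_and] at hp
    rw [avoids_mk, desF_mk, mk_zero] at hp
    obtain ⟨h1, h2, rfl⟩ := hp
    exact ⟨q, by simp only [Finset.mem_filter, Finset.mem_univ, true_and]; exact ⟨h1, h2⟩, rfl⟩

lemma t_succ_zero (n D : ℕ) (h : D ≤ n + 1) : t (n+1) 0 D = t n 0 D := by
  classical
  rw [t_eq n 0 D h]
  unfold t
  congr 1
  ext q
  simp only [Finset.mem_filter, Finset.mem_univ, true_and]
  split_ifs with hq
  · constructor
    · rintro ⟨_, h⟩; exact h.elim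
    · rintro ⟨_, _, h⟩; omega
  · constructor
    · rintro ⟨⟨h1, h2⟩, h⟩; exact ⟨h1, by omega, by omega⟩
    · rintro ⟨h1, h2, h⟩; exact ⟨⟨h1, by omega⟩, by omega⟩

lemma t_succ_succ (n k D : ℕ) (h : D ≤ n + 1) :
    t (n+1) (k+1) D = t n (k+1) D + s n k D := by
  classical
  rw [t_eq n (k+1) D h]
  unfold t s
  rw [← Finset.card_union_of_disjoint]
  · congr 1
    ext q
    simp only [Finset.mem_filter, Finset.mem_union, Finset.mem_univ, true_and]
    split_ifs with hq
    · constructor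
      · rintro ⟨⟨h1, h2⟩, h⟩; exact Or.inr ⟨h1, by omega, hq⟩
      · rintro (⟨h1, h2, h⟩ | ⟨h1, h2, h⟩)
        · omega
        · exact ⟨⟨h1, by omega⟩, by omega⟩
    · constructor
      · rintro ⟨⟨h1, h2⟩, h⟩; exact Or.inl ⟨h1, by omega, by omega⟩
      · rintro (⟨h1, h2, h⟩ | ⟨h1, h2, h⟩)
        · exact ⟨⟨h1, by omega⟩, by omega⟩
        · omega
  · rw [Finset.disjoint_filter]
    rintro p - ⟨_, _, h⟩ ⟨_, _, h'⟩
    omega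

/-- closed form for `t` -/
def f (n : ℕ) : ℕ → ℕ → ℤ
  | 0, 0 => 1
  | 0, _+1 => 0
  | _+1, 0 => 0
  | k+1, D+1 => n.choose (k+1) * D.choose k - n.choose k * D.choose (k+1)

/-- closed form for `s n k (D+1)` -/
def g (n : ℕ) : ℕ → ℕ → ℤ
  | 0, _ => 1
  | k+1, D => n.choose (k+1) * D.choose (k+1) - n.choose k * D.choose (k+2)

lemma s_closed (n : ℕ) (ht : ∀ k D, D ≤ n + 1 → (t n k D : ℤ) = f n k D) (k D : ℕ)
    (hD : D ≤ n + 1) : (s n k (D+1) : ℤ) = g n k D := by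
  induction D with
  | zero =>
    rw [s_succ, s_zero, Nat.zero_add, ht _ _ hD]
    cases k <;> simp [f, g]
  | succ D ih =>
    rw [s_succ, Nat.cast_add, ih (by omega), ht _ _ hD]
    cases k with
    | zero => simp [f, g]
    | succ k =>
      simp only [f, g, Nat.choose_succ_succ D k, Nat.choose_succ_succ D (k+1)]
      push_cast
      ring

lemma t_closed (n : ℕ) : ∀ k D, D ≤ n + 1 → (t n k D : ℤ) = f n k D := by
  classical
  induction n with
  | zero =>
    intro k D hD
    have hs : t 0 k D = if k = 0 ∧ D = 0 then 1 else 0 := by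
      have hA : ∀ p : Equiv.Perm (Fin (0+1)), Avoids132 p := by
        intro p a b c hab
        omega
      have h0 : ∀ p : Equiv.Perm (Fin (0+1)), (p 0).val = 0 := by
        intro p
        omega
      have hd : ∀ p : Equiv.Perm (Fin (0+1)), desF p = 0 := by
        intro p
        simp [desF]
      unfold t
      simp only [hA, h0, hd, true_and]
      split_ifs with h
      · simp [h.1, h.2]
      · rw [Finset.card_eq_zero, Finset.filter_eq_empty_iff]
        rintro p - ⟨h1, h2⟩
        exact h ⟨h1.symm, h2.symm⟩
    rw [hs]
    rcases k with _ | k <;> rcases D with _ | D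
    · simp [f]
    · simp [f]
    · simp [f]
    · obtain rfl : D = 0 := by omega
      simp only [f]
      push_cast
      simp
  | succ n ih =>
    intro k D hD
    rcases Nat.lt_or_ge (n+1) D with h | h
    · obtain rfl : D = n + 1 + 1 := by omega
      rw [t_big _ _ _ h]
      rcases k with _ | k
      · simp [f]
      · simp only [f]; push_cast; ring
    · rcases k with _ | k
      · rw [t_succ_zero n D h, ih _ _ h]
        rcases D with _ | D <;> rfl
      · rw [t_succ_succ n k D h, Nat.cast_add, ih _ _ h]
        rcases D with _ | D
        · simp [f, s_zero]
        · rw [s_closed n ih k D (by omega)]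
          rcases k with _ | k
          · simp [f, g]; ring
          · simp only [f, g, Nat.choose_succ_succ n (k+1), Nat.choose_succ_succ n k]
            push_cast
            ring

lemma g_final (n k : ℕ) (hk : k ≤ n) :
    ((n : ℤ) + 1) * g n k n = (n+1).choose k * (n+1).choose (k+1) := by
  rcases k with _ | k
  · simp [g]
  · simp only [g]
    have e1 : ((n : ℤ) + 1) * n.choose k = (n+1).choose (k+1) * (k+1) := by
      exact_mod_cast Nat.add_one_mul_choose_eq n k
    have e2 : ((n : ℤ) + 1) * n.choose (k+1) = (n+1).choose (k+2) * (k+2) := by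
      exact_mod_cast Nat.add_one_mul_choose_eq n (k+1)
    have e3 : ((n+1).choose (k+1) : ℤ) = n.choose k + n.choose (k+1) := by
      exact_mod_cast Nat.choose_succ_succ n k
    have e4 : ((n+1).choose (k+2) : ℤ) = n.choose (k+1) + n.choose (k+2) := by
      exact_mod_cast Nat.choose_succ_succ n (k+1)
    show ((n : ℤ) + 1) * _ = ((n+1).choose (k+1) : ℤ) * ((n+1).choose (k+2) : ℤ)
    linear_combination ((n+1).choose (k+1) : ℤ) * e2 - ((n+1).choose (k+2) : ℤ) * e1
      - ((n:ℤ)+1) * n.choose (k+1) * e3 + ((n:ℤ)+1) * n.choose k * e4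

end Nara

/-- `n` times the number of 132-avoiding permutations of `[n]` with exactly
`k` descents equals `C(n,k) * C(n,k+1)` (the Narayana number times `n`). -/
theorem stmt3 (n k : ℕ) (hn : 1 ≤ n) (hk : k ≤ n - 1) :
    n * Nat.card {p : Equiv.Perm (Fin n) // Avoids132 p ∧ (Des p).ncard = k} =
      n.choose k * n.choose (k + 1) := by
  classical
  obtain ⟨n, rfl⟩ : ∃ m, n = m + 1 := ⟨n - 1, by omega⟩
  have h : Nat.card {p : Equiv.Perm (Fin (n+1)) // Avoids132 p ∧ (Des p).ncard = k}
      = Nara.s n k (n+1) := by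
    rw [Nat.card_eq_fintype_card, Fintype.card_subtype]
    unfold Nara.s
    congr 1
    ext p
    simp only [Nara.desF_eq, Finset.mem_filter, Finset.mem_univ, true_and]
    have := (p 0).isLt
    tauto
  rw [h]
  have h1 := Nara.s_closed n (Nara.t_closed n) k n (by omega)
  have h2 := Nara.g_final n k (by omega)
  rw [← h1] at h2
  exact_mod_cast h2
end

section
/- Let n ≥ 1. Consider the partial order P^A_n on the set of 132-avoiding permutations of [n] in which p ≤ q iff p = q or Des(p) is a proper subset of Des(q). P^A_n is strongly Sperner: for every k ≥ 1 and any antichains A_1, …, A_k of P^A_n, n·|A_1 ∪ ⋯ ∪ A_k| is at most the maximum, over all k-element subsets T of {0,1,…,n−1}, of Σ_{j∈T} C(n,j)·C(n,j+1) (i.e., the union of k antichains has size at most the sum of the k largest Narayana numbers (1/n)C(n,j)C(n,j+1)). -/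
/-- Plane binary trees. -/
inductive BT : Type
  | leaf : BT
  | node : BT → BT → BT

namespace BT

def size : BT → ℕ
  | leaf => 0
  | node u v => size u + size v + 1

def enc : BT → List ℕ
  | leaf => []
  | node u v => (enc v ++ (enc u).map Nat.succ) ++ [0]

def word : BT → List Bool
  | leaf => []
  | node leaf leaf => []
  | node (node a b) leaf => word (node a b) ++ [false]
  | node leaf (node c d) => word (node c d) ++ [true]
  | node (node a b) (node c d) => word (node c d) ++ true :: (word (node a b) ++ [false])

def rk : BT → ℕ
  | leaf => 0
  | node leaf leaf => 0
  | node (node a b) leaf => rk (node a b)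
  | node leaf (node c d) => rk (node c d) + 1
  | node (node a b) (node c d) => rk (node a b) + rk (node c d) + 1

theorem length_enc (t : BT) : (enc t).length = size t := by
  induction t with
  | leaf => rfl
  | node u v hu hv => simp [enc, size, hu, hv]; omega

theorem enc_end (t : BT) : enc t = [] ∨ ∃ E, enc t = E ++ [0] := by
  cases t with
  | leaf => left; rfl
  | node u v => right; exact ⟨_, rfl⟩

theorem split_aux (X Y Z W : List ℕ) (hZ : Z = [] ∨ ∃ E, Z = E ++ [0])
    (D : List ℕ) (h1 : Z = X ++ D) (h2 : Y.map Nat.succ = D ++ W.map Nat.succ) : D = [] := by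
  rcases List.eq_nil_or_concat D with rfl | ⟨D', d, rfl⟩
  · rfl
  · exfalso
    have hd : d ∈ Y.map Nat.succ := by rw [h2]; simp
    rcases hZ with rfl | ⟨E, rfl⟩
    · simp at h1
    · rw [List.concat_eq_append, ← List.append_assoc] at h1
      have := (List.append_inj' h1 rfl).2
      simp at this
      subst this
      simp at hd

theorem enc_inj : ∀ s t : BT, enc s = enc t → s = t := by
  intro s
  induction s with
  | leaf =>
    intro t h
    cases t with
    | leaf => rfl
    | node u v => simp [enc] at h
  | node u v hu hv =>
    intro t h
    cases t with
    | leaf => simp [enc] at h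
    | node u' v' =>
      simp only [enc] at h
      have h := List.append_cancel_right h
      have key : enc v = enc v' ∧ (enc u).map Nat.succ = (enc u').map Nat.succ := by
        rcases List.append_eq_append_iff.1 h with ⟨D, h1, h2⟩ | ⟨D, h1, h2⟩
        · have := split_aux _ _ _ _ (enc_end v') D h1 h2
          subst this; simp_all
        · have := split_aux _ _ _ _ (enc_end v) D h1 h2
          subst this; simp_all
      have h3 := List.map_injective_iff.2 Nat.succ_injective key.2
      rw [hu _ h3, hv _ key.1]

theorem count_word (t : BT) : (word t).count true = rk t := by
  fun_induction word t <;> simp_all [rk] <;> omega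

theorem length_word (t : BT) : (word t).length = size t - 1 := by
  fun_induction word t <;> simp_all [size] <;> omega

end BT

/-- weak-descent word of a list -/
def wl : List ℕ → List Bool
  | [] => []
  | [_] => []
  | a :: b :: l => decide (a ≤ b) :: wl (b :: l)

theorem wl_append (X Y : List ℕ) (a b : ℕ) :
    wl (X ++ a :: b :: Y) = wl (X ++ [a]) ++ decide (a ≤ b) :: wl (b :: Y) := by
  induction X with
  | nil => simp [wl]
  | cons x X ih =>
    cases X with
    | nil => simp [wl]
    | cons x' X => simpa [wl] using ih

theorem wl_succ (X : List ℕ) : wl (X.map Nat.succ) = wl X := by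
  fun_induction wl X <;> simp_all [wl]

def lrk (l : List ℕ) : ℕ := (wl l).count true

namespace BT

theorem wl_enc (t : BT) : wl (enc t) = word t := by
  fun_induction word t with
  | case1 => rfl
  | case2 => rfl
  | case3 a b ih =>
    obtain ⟨E, hE⟩ : ∃ E, enc (node a b) = E ++ [0] := ⟨_, rfl⟩
    rw [← ih, ← wl_succ (enc (node a b)), enc, hE]
    simp [enc, wl_append (E.map Nat.succ) [] 1 0, wl]
  | case4 c d ih =>
    obtain ⟨E, hE⟩ : ∃ E, enc (node c d) = E ++ [0] := ⟨_, rfl⟩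
    rw [← ih, enc, hE]
    simp [enc, wl_append E [] 0 0, wl]
  | case5 a b c d ih1 ih2 =>
    obtain ⟨E, hE⟩ : ∃ E, enc (node c d) = E ++ [0] := ⟨_, rfl⟩
    obtain ⟨F, hF⟩ : ∃ E, enc (node a b) = E ++ [0] := ⟨_, rfl⟩
    have h3 := wl_append (F.map Nat.succ) [] 1 0
    rw [← ih1, ← ih2, ← wl_succ (enc (node a b)), enc, hE, hF]
    cases F with
    | nil => simp [wl_append E [0] 0 1, wl]
    | cons f F =>
      simp at h3
      simp [wl_append E _ 0 (f+1), h3, wl]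

theorem lrk_enc (t : BT) : lrk (enc t) = rk t := by rw [lrk, wl_enc, count_word]

theorem enc_cons (t : BT) : ∀ a b l, enc t = b :: l → a ≤ b + 1 → ∃ t', enc t' = a :: enc t := by
  induction t with
  | leaf => intro a b l h; simp [enc] at h
  | node u v hu hv =>
    intro a b l h hab
    cases v with
    | node c d =>
      rcases hh : enc (node c d) with _ | ⟨b', l'⟩
      · simp [enc] at hh
      · rw [enc, hh] at h
        simp at h
        obtain ⟨v', hv'⟩ := hv a b' l' hh (by omega)
        exact ⟨node u v', by rw [enc, hv', enc.eq_2 u]; simp⟩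
    | leaf =>
      rcases a with _ | a
      · exact ⟨node u (node leaf leaf), by simp [enc]⟩
      · rcases hh : enc u with _ | ⟨b', l'⟩
        · rw [enc, hh] at h
          simp [enc] at h
          refine ⟨node (node leaf leaf) leaf, ?_⟩
          simp [enc, hh]; omega
        · rw [enc, hh] at h
          simp [enc] at h
          obtain ⟨u', hu'⟩ := hu a b' l' hh (by omega)
          exact ⟨node u' leaf, by simp [enc, hu']⟩

end BT

def Val : List ℕ → Prop
  | [] => True
  | [a] => a = 0
  | a :: b :: l => a ≤ b + 1 ∧ Val (b :: l)

theorem exists_tree (l : List ℕ) (h : Val l) : ∃ t, BT.enc t = l := by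
  fun_induction Val l with
  | case1 => exact ⟨.leaf, rfl⟩
  | case2 a => subst h; exact ⟨.node .leaf .leaf, rfl⟩
  | case3 a b l ih =>
    obtain ⟨t, ht⟩ := ih h.2
    obtain ⟨t', ht'⟩ := BT.enc_cons t a b l ht h.1
    exact ⟨t', by rw [ht', ht]⟩

theorem val_enc_aux (X Y : List ℕ) (hX : Val X) (hX0 : X = [] ∨ ∃ E, X = E ++ [0]) (hY : Val Y) :
    Val ((X ++ Y.map Nat.succ) ++ [0]) := by
  have hY' : Val (Y.map Nat.succ ++ [0]) := by
    clear hX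
    fun_induction Val Y <;> simp_all [Val]
  rcases hX0 with rfl | ⟨E, rfl⟩
  · simpa using hY'
  · induction E with
    | nil =>
      cases Y with
      | nil => simp [Val]
      | cons y Y => simp_all [Val]
    | cons x E ih =>
      cases E with
      | nil => simp_all [Val]
      | cons x' E => simp_all [Val]

theorem val_enc (t : BT) : Val (BT.enc t) := by
  induction t with
  | leaf => trivial
  | node u v hu hv => exact val_enc_aux _ _ hv (BT.enc_end v) hu

/-- Labels of the chains in the symmetric chain decomposition. -/
inductive CD : Type
  | nil : CD
  | one : CD
  | two : CD → ℕ → CD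
  | prod : CD → CD → ℕ → CD

namespace CD
def size : CD → ℕ
  | nil => 0
  | one => 1
  | two c _ => size c + 1
  | prod c d _ => size c + size d + 1
def bot : CD → ℕ
  | nil => 0
  | one => 0
  | two c t => bot c + t
  | prod c d t => bot c + bot d + t + 1
end CD

namespace BT

def cid : BT → CD
  | leaf => .nil
  | node leaf leaf => .one
  | node (node a b) leaf => .two (cid (node a b)) 0
  | node leaf (node c d) => .two (cid (node c d))
      (min 1 (size (node c d) - 1 - (cid (node c d)).bot - rk (node c d)))
  | node (node a b) (node c d) => .prod (cid (node a b)) (cid (node c d))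
      (min (rk (node a b) - (cid (node a b)).bot)
        (size (node c d) - 1 - (cid (node c d)).bot - rk (node c d)))

theorem csize_cid (t : BT) : (cid t).size = size t := by
  fun_induction cid t <;> simp_all [CD.size, size] 

theorem cid_range (t : BT) (ht : t ≠ leaf) :
    (cid t).bot ≤ rk t ∧ rk t + (cid t).bot + 1 ≤ size t := by
  fun_induction cid t with
  | case1 => simp at ht
  | case2 => simp [CD.bot, rk, size]
  | case3 a b ih => 
    have := ih (by simp)
    simp only [CD.bot, rk]
    rw [size]; omega
  | case4 c d ih => 
    have := ih (by simp)
    simp only [CD.bot, rk]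
    rw [size.eq_2 leaf]; omega
  | case5 a b c d ih1 ih2 =>
    have := ih1 (by simp)
    have := ih2 (by simp)
    simp only [CD.bot, rk]
    rw [size.eq_2 (node a b)]; omega

def BL (a b : Bool) : Prop := a = true → b = true

theorem cid_chain (x : BT) : ∀ y, cid x = cid y → rk x ≤ rk y →
    List.Forall₂ BL (word x) (word y) ∧ (rk x = rk y → x = y) := by
  fun_induction cid x with
  | case1 =>
    intro y
    fun_cases cid y <;> simp [word]
  | case2 =>
    intro y
    fun_cases cid y <;> simp [word]
  | case3 a b ih =>
    intro y
    fun_cases cid y with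
    | case1 => simp
    | case2 => simp
    | case3 a' b' =>
      intro h hr
      simp only [CD.two.injEq, and_true] at h
      obtain ⟨h1, h2⟩ := ih _ h hr
      refine ⟨?_, fun he => by rw [h2 he]⟩
      exact List.rel_append h1 (by simp [BL])
    | case4 c' d' =>
      intro h hr
      simp only [CD.two.injEq] at h
      have r1 := cid_range (node a b) (by simp)
      have r2 := cid_range (node c' d') (by simp)
      have s1 := csize_cid (node a b)
      have s2 := csize_cid (node c' d')
      have hs : size (node a b) = size (node c' d') := by rw [← s1, ← s2, h.1]
      have hb : (cid (node a b)).bot = (cid (node c' d')).bot := by rw [h.1]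
      have hm : rk (node a b) ≤ rk (node c' d') := by omega
      obtain ⟨h1, h2⟩ := ih _ h.1 hm
      simp only [rk] at *
      refine ⟨?_, fun he => by omega⟩
      exact List.rel_append h1 (by simp [BL])
    | case5 => simp
  | case4 c d ih =>
    intro y
    fun_cases cid y with
    | case1 => simp
    | case2 => simp
    | case3 a b =>
      intro h hr
      exfalso
      simp only [CD.two.injEq] at h
      have r1 := cid_range (node a b) (by simp)
      have r2 := cid_range (node c d) (by simp)
      have s1 := csize_cid (node a b)
      have s2 := csize_cid (node c d)
      have hs : size (node a b) = size (node c d) := by rw [← s1, ← s2, h.1]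
      have hb : (cid (node a b)).bot = (cid (node c d)).bot := by rw [h.1]
      simp only [rk] at hr
      omega
    | case4 c' d' =>
      intro h hr
      simp only [CD.two.injEq] at h
      simp only [rk] at hr
      obtain ⟨h1, h2⟩ := ih _ h.1 (by omega)
      refine ⟨?_, fun he => by rw [h2 (by simpa [rk] using he)]⟩
      exact List.rel_append h1 (by simp [BL])
    | case5 => simp
  | case5 a b c d ih1 ih2 =>
    intro y
    fun_cases cid y with
    | case1 => simp
    | case2 => simp
    | case3 => simp
    | case4 => simp
    | case5 a' b' c' d' =>
      intro h hr
      simp only [CD.prod.injEq] at h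
      obtain ⟨h1, h2, h3⟩ := h
      have r1 := cid_range (node a b) (by simp)
      have r2 := cid_range (node c d) (by simp)
      have r1' := cid_range (node a' b') (by simp)
      have r2' := cid_range (node c' d') (by simp)
      have hs : size (node c d) = size (node c' d') := by rw [← csize_cid, ← csize_cid, h2]
      have hb : (cid (node a b)).bot = (cid (node a' b')).bot := by rw [h1]
      have hb' : (cid (node c d)).bot = (cid (node c' d')).bot := by rw [h2]
      simp only [rk] at hr
      obtain ⟨p1, p2⟩ := ih1 _ h1 (by omega)
      obtain ⟨q1, q2⟩ := ih2 _ h2 (by omega)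
      refine ⟨?_, fun he => ?_⟩
      · refine List.rel_append q1 (List.Forall₂.cons (by simp [BL]) ?_)
        exact List.rel_append p1 (by simp [BL])
      · simp only [rk] at he
        rw [p2 (by omega), q2 (by omega)]

theorem cid_ne_leaf {x y : BT} (hx : x ≠ leaf) (h : cid y = cid x) : y ≠ leaf := by
  rintro rfl
  revert h
  fun_cases cid x <;> simp_all [cid]

theorem cid_full (x : BT) (hx : x ≠ leaf) : ∀ j, (cid x).bot ≤ j → j + (cid x).bot + 1 ≤ size x →
    ∃ y, cid y = cid x ∧ rk y = j := by
  fun_induction cid x with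
  | case1 => simp at hx
  | case2 => 
    intro j h1 h2
    refine ⟨node leaf leaf, rfl, ?_⟩
    simp [rk, size] at *; omega
  | case3 a b ih =>
    intro j h1 h2
    have r := cid_range (node a b) (by simp)
    simp only [CD.bot] at h1 h2
    rw [size.eq_2 _ leaf] at h2
    simp only [size.eq_1] at h2
    by_cases hj : j + (cid (node a b)).bot + 1 ≤ size (node a b)
    · obtain ⟨y, hy, hy'⟩ := ih (by simp) j (by omega) hj
      have := cid_ne_leaf (by simp) hy
      cases y with
      | leaf => simp at this
      | node a' b' => exact ⟨node (node a' b') leaf, by rw [cid, hy], by rw [rk, hy']⟩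
    · obtain ⟨y, hy, hy'⟩ := ih (by simp) (j-1) (by omega) (by omega)
      have := cid_ne_leaf (by simp) hy
      cases y with
      | leaf => simp at this
      | node a' b' =>
        have hs : size (node a b) = size (node a' b') := by rw [← csize_cid, ← csize_cid, hy]
        refine ⟨node leaf (node a' b'), ?_, by rw [rk, hy']; omega⟩
        rw [cid, hy]
        congr 1
        omega
  | case4 c d ih =>
    intro j h1 h2
    have r := cid_range (node c d) (by simp)
    simp only [CD.bot] at h1 h2
    rw [size.eq_2 leaf _] at h2
    simp only [size.eq_1] at h2
    by_cases h0 : min 1 (size (node c d) - 1 - (cid (node c d)).bot - rk (node c d)) = 0 ∧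
        j + (cid (node c d)).bot + 1 ≤ size (node c d)
    · obtain ⟨y, hy, hy'⟩ := ih (by simp) j (by omega) (by omega)
      have := cid_ne_leaf (by simp) hy
      cases y with
      | leaf => simp at this
      | node a' b' => exact ⟨node (node a' b') leaf, by rw [cid, hy, h0.1], by rw [rk, hy']⟩
    · obtain ⟨y, hy, hy'⟩ := ih (by simp) (j-1) (by omega) (by omega)
      have := cid_ne_leaf (by simp) hy
      cases y with
      | leaf => simp at this
      | node a' b' =>
        have hs : size (node c d) = size (node a' b') := by rw [← csize_cid, ← csize_cid, hy]
        refine ⟨node leaf (node a' b'), ?_, by rw [rk, hy']; omega⟩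
        rw [cid, hy]
        congr 1
        omega
  | case5 a b c d ih1 ih2 =>
    intro j h1 h2
    have r1 := cid_range (node a b) (by simp)
    have r2 := cid_range (node c d) (by simp)
    simp only [CD.bot] at h1 h2
    rw [size.eq_2 (node a b) _] at h2
    generalize ht : min (rk (node a b) - (cid (node a b)).bot)
        (size (node c d) - 1 - (cid (node c d)).bot - rk (node c d)) = t at *
    have key : ∃ i l, i + l + 1 = j ∧ (cid (node a b)).bot ≤ i ∧ 
        i + (cid (node a b)).bot + 1 ≤ size (node a b) ∧ (cid (node c d)).bot ≤ l ∧
        l + (cid (node c d)).bot + 1 ≤ size (node c d) ∧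
        min (i - (cid (node a b)).bot) (size (node c d) - 1 - (cid (node c d)).bot - l) = t := by
      by_cases hj : j + t + 2 ≤ (cid (node a b)).bot + t + size (node c d) - (cid (node c d)).bot + 1
      · exact ⟨(cid (node a b)).bot + t, j - 1 - ((cid (node a b)).bot + t), by omega, by omega,
          by omega, by omega, by omega, by omega⟩
      · exact ⟨j - 1 - (size (node c d) - 1 - (cid (node c d)).bot - t), 
          (size (node c d) - 1 - (cid (node c d)).bot - t), by omega, by omega,
          by omega, by omega, by omega, by omega⟩
    obtain ⟨i, l, hil, hi1, hi2, hl1, hl2, hm⟩ := key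
    obtain ⟨y, hy, hy'⟩ := ih1 (by simp) i hi1 hi2
    obtain ⟨z, hz, hz'⟩ := ih2 (by simp) l hl1 hl2
    have := cid_ne_leaf (by simp) hy
    have := cid_ne_leaf (by simp) hz
    cases y with
    | leaf => simp at *
    | node a' b' => 
    cases z with
    | leaf => simp at *
    | node c' d' => 
    have hs : size (node c d) = size (node c' d') := by rw [← csize_cid, ← csize_cid, hz]
    refine ⟨node (node a' b') (node c' d'), ?_, by rw [rk, hy', hz']; omega⟩
    rw [cid, hy, hz, hy', hz', ← hs, hm]

end BT

/-- All valid code lists of length `n+1`. -/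
def SL : ℕ → Finset (List ℕ)
  | 0 => {[0]}
  | n + 1 => (SL n).biUnion fun l => (Finset.range (l.headD 0 + 2)).image (fun a => a :: l)

theorem mem_SL (n : ℕ) : ∀ l, l ∈ SL n ↔ Val l ∧ l.length = n + 1 := by
  induction n with
  | zero =>
    intro l
    simp only [SL, Finset.mem_singleton]
    rcases l with _ | ⟨a, _ | ⟨b, l⟩⟩ <;> simp [Val]
  | succ n ih =>
    intro l
    simp only [SL, Finset.mem_biUnion, Finset.mem_image, Finset.mem_range, ih]
    constructor
    · rintro ⟨l, ⟨h1, h2⟩, a, h3, rfl⟩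
      rcases l with _ | ⟨b, l⟩
      · simp at h2
      · simp at h3
        simp [Val, h1] at *
        omega
    · rintro ⟨h1, h2⟩
      rcases l with _ | ⟨a, _ | ⟨b, l⟩⟩
      · simp at h2
      · simp at h2
      · simp only [Val] at h1
        exact ⟨b :: l, ⟨h1.2, by simpa using h2⟩, a, by simp; omega, rfl⟩

/-- number of codes with rank `j` and head at least `a` -/
def GG (n j a : ℕ) : ℕ := ((SL n).filter fun l => lrk l = j ∧ a ≤ l.headD 0).card
def FF (n j a : ℕ) : ℕ := ((SL n).filter fun l => lrk l = j ∧ l.headD 0 = a).card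

theorem GG_eq (n j a : ℕ) : GG n j a = FF n j a + GG n j (a + 1) := by
  unfold GG FF
  rw [← Finset.card_union_of_disjoint]
  · congr 1
    ext l
    simp only [Finset.mem_union, Finset.mem_filter]
    by_cases h1 : l ∈ SL n <;> by_cases h2 : lrk l = j <;> simp [h1, h2]
    omega
  · rw [Finset.disjoint_left]
    intro l
    simp only [Finset.mem_filter]
    omega

theorem lrk_cons (a : ℕ) (l : List ℕ) (hl : l ≠ []) :
    lrk (a :: l) = lrk l + if a ≤ l.headD 0 then 1 else 0 := by
  rcases l with _ | ⟨b, l⟩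
  · simp at hl
  · simp [lrk, wl, List.count_cons]

theorem FF_succ (n j a : ℕ) : FF (n + 1) j a =
    ((SL n).filter fun l => lrk (a :: l) = j ∧ a ≤ l.headD 0 + 1).card := by
  unfold FF
  symm
  apply Finset.card_bij (fun l _ => a :: l)
  · intro l hl
    simp only [Finset.mem_filter, SL, Finset.mem_biUnion, Finset.mem_image, Finset.mem_range] at *
    exact ⟨⟨l, hl.1, a, by omega, rfl⟩, hl.2.1, by simp⟩
  · intro l _ l' _ h
    simpa using h
  · intro l hl
    simp only [Finset.mem_filter, SL, Finset.mem_biUnion, Finset.mem_image, Finset.mem_range] at *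
    obtain ⟨⟨l', h1, a', h2, rfl⟩, h3, h4⟩ := hl
    simp at h4
    subst h4
    exact ⟨l', ⟨h1, h3, by omega⟩, rfl⟩

theorem SL_ne_nil {n : ℕ} {l : List ℕ} (h : l ∈ SL n) : l ≠ [] := by
  rintro rfl
  rw [mem_SL] at h
  simp at h

theorem FF_rec_zero_zero (n : ℕ) : FF (n + 1) 0 0 = 0 := by
  rw [FF_succ, Finset.card_eq_zero, Finset.filter_eq_empty_iff]
  intro l hl
  rw [lrk_cons _ _ (SL_ne_nil hl)]
  simp

theorem FF_rec_zero_succ (n a : ℕ) : FF (n + 1) 0 (a + 1) = FF n 0 a := by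
  rw [FF_succ, FF]
  congr 1
  apply Finset.filter_congr
  intro l hl
  rw [lrk_cons _ _ (SL_ne_nil hl)]
  by_cases hh : a + 1 ≤ l.headD 0
  · rw [if_pos hh]
    constructor
    · rintro ⟨h1, h2⟩; exact absurd h1 (Nat.succ_ne_zero _)
    · omega
  · rw [if_neg hh]
    omega

theorem FF_rec_succ_zero (n j : ℕ) : FF (n + 1) (j + 1) 0 = GG n j 0 := by
  rw [FF_succ, GG]
  congr 1
  apply Finset.filter_congr
  intro l hl
  rw [lrk_cons _ _ (SL_ne_nil hl)]
  split_ifs <;> omega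

theorem FF_rec_succ_succ (n j a : ℕ) :
    FF (n + 1) (j + 1) (a + 1) = FF n (j + 1) a + GG n j (a + 1) := by
  rw [FF_succ, GG, FF, ← Finset.card_union_of_disjoint]
  · congr 1
    ext l
    simp only [Finset.mem_union, Finset.mem_filter]
    by_cases hl : l ∈ SL n
    · rw [lrk_cons _ _ (SL_ne_nil hl)]
      simp only [hl, true_and]
      split_ifs <;> omega
    · simp [hl]
  · rw [Finset.disjoint_left]
    intro l
    simp only [Finset.mem_filter]
    omega

theorem GG_big (n j a : ℕ) (h : n < a) : GG n j a = 0 := by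
  rw [GG, Finset.card_eq_zero, Finset.filter_eq_empty_iff]
  rintro l hl ⟨-, h2⟩
  have : ∀ n, ∀ l ∈ SL n, l.headD 0 ≤ n := by
    intro n
    induction n with
    | zero => simp [SL]
    | succ n ih =>
      intro l hl
      simp only [SL, Finset.mem_biUnion, Finset.mem_image, Finset.mem_range] at hl
      obtain ⟨l', h1, a', h2, rfl⟩ := hl
      have := ih _ h1
      simp
      omega
  have := this n l hl
  omega

/-- `C(n, j-1)` -/
def chp (n : ℕ) : ℕ → ℕ
  | 0 => 0
  | j + 1 => n.choose j

/-- closed form, with d = n - a -/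
def HH (n j d : ℕ) : ℤ := n.choose j * d.choose j - chp n j * d.choose (j + 1)

theorem HH_step (n j d : ℕ) : HH n j (d + 1) - HH n j d =
    n.choose j * chp d j - chp n j * d.choose j := by
  cases j <;> simp [HH, chp, Nat.choose_succ_succ] <;> ring

theorem FF_of_GG (n : ℕ) (ih : ∀ j d a, a + d = n → (GG n j a : ℤ) = HH n j d) (j d a : ℕ)
    (h : a + d = n) : (FF n j a : ℤ) = if d = 0 then HH n j 0 else HH n j d - HH n j (d - 1) := by
  have h1 := GG_eq n j a
  split_ifs with hd
  · subst hd
    rw [GG_big n j (a + 1) (by omega)] at h1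
    rw [← ih j 0 a h]; omega
  · rw [← ih j d a h, ← ih j (d - 1) (a + 1) (by omega)]
    omega

theorem FF_closed (n : ℕ) (ih : ∀ j d a, a + d = n → (GG n j a : ℤ) = HH n j d) (j d a : ℕ)
    (h : a + d = n + 1) :
    (FF (n + 1) j a : ℤ) = if d = 0 then HH (n + 1) j 0 else
      HH (n + 1) j d - HH (n + 1) j (d - 1) := by
  have key : ∀ j d, HH (n + 1) j (d + 1) - HH (n + 1) j d =
    (n + 1).choose j * chp d j - chp (n + 1) j * d.choose j := HH_step (n + 1)
  cases j with
  | zero =>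
    cases a with
    | zero =>
      rw [FF_rec_zero_zero]
      have : d = (n + 1) := by omega
      subst this
      simp [key, chp]
    | succ a =>
      rw [FF_rec_zero_succ, FF_of_GG n ih 0 d a (by omega)]
      simp [HH, chp]
  | succ j =>
    cases a with
    | zero =>
      rw [FF_rec_succ_zero]
      have : d = n + 1 := by omega
      subst this
      rw [ih j n 0 (by omega)]
      simp only [Nat.add_one_ne_zero, if_false, Nat.add_sub_cancel, key]
      cases j <;> simp [HH, chp, Nat.choose_succ_succ] <;> ring
    | succ a =>
      rw [FF_rec_succ_succ]
      push_cast
      rw [FF_of_GG n ih (j + 1) d a (by omega)]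
      cases d with
      | zero => 
        rw [GG_big _ _ _ (by omega)]
        simp [HH]
      | succ d =>
        rw [ih j d (a + 1) (by omega)]
        simp only [Nat.add_one_ne_zero, if_false, Nat.add_sub_cancel, key, HH_step]
        cases j <;> simp [HH, chp, Nat.choose_succ_succ] <;> ring

theorem GG_closed (n : ℕ) : ∀ j d a, a + d = n → (GG n j a : ℤ) = HH n j d := by
  induction n with
  | zero =>
    intro j d a h
    have h1 : a = 0 := by omega
    have h2 : d = 0 := by omega
    subst h1 h2
    cases j <;> simp [GG, SL, HH, lrk, wl, Finset.filter_singleton]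
  | succ n ih =>
    intro j d
    induction d with
    | zero =>
      intro a h
      rw [GG_eq, GG_big _ _ (a + 1) (by omega)]
      push_cast
      rw [FF_closed n ih j 0 a h]
      simp
    | succ d ihd =>
      intro a h
      rw [GG_eq]
      push_cast
      rw [ihd (a + 1) (by omega), FF_closed n ih j (d + 1) a h]
      simp

theorem nar_aux (m j : ℕ) :
    ((m : ℤ) + 1) * HH m j m = ((m + 1).choose j : ℤ) * (m + 1).choose (j + 1) := by
  cases j with
  | zero => simp [HH, chp]
  | succ j =>
    have e1 : ((m.choose (j + 1) : ℕ) : ℚ) * (j + 1) = m.choose j * (m - j) := by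
      rcases le_or_gt j m with h | h
      · have := Nat.choose_succ_right_eq m j
        rw [← Nat.cast_sub h]
        exact_mod_cast this
      · rw [Nat.choose_eq_zero_of_lt h, Nat.choose_eq_zero_of_lt (by omega)]; simp
    have e2 : ((m.choose (j + 1 + 1) : ℕ) : ℚ) * (j + 1 + 1) = m.choose (j + 1) * (m - (j + 1)) := by
      rcases le_or_gt (j + 1) m with h | h
      · have := Nat.choose_succ_right_eq m (j + 1)
        have h' : ((m : ℚ) - (j + 1)) = ((m - (j + 1) : ℕ) : ℚ) := by rw [Nat.cast_sub h]; simp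
        rw [h']
        exact_mod_cast this
      · rw [Nat.choose_eq_zero_of_lt h, Nat.choose_eq_zero_of_lt (by omega)]; simp
    have : ((m : ℚ) + 1) * (m.choose (j + 1) * m.choose (j + 1) - m.choose j * m.choose (j + 1 + 1))
        = (m.choose j + m.choose (j + 1)) * (m.choose (j + 1) + m.choose (j + 1 + 1)) := by
      have e1' : ((m.choose (j + 1) : ℕ) : ℚ) = m.choose j * (m - j) / (j + 1) := by
        field_simp; linarith
      have e2' : ((m.choose (j + 1 + 1) : ℕ) : ℚ) = m.choose (j + 1) * (m - (j + 1)) / (j + 1 + 1) := by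
        field_simp; linarith
      rw [e2', e1']
      field_simp
      ring
    rw [Nat.choose_succ_succ m j, Nat.choose_succ_succ m (j + 1), HH, chp]
    exact_mod_cast this

theorem card_SL (m j : ℕ) : (m + 1) * ((SL m).filter fun l => lrk l = j).card =
    (m + 1).choose j * (m + 1).choose (j + 1) := by
  have h := GG_closed m j m 0 (by omega)
  have h2 : ((SL m).filter fun l => lrk l = j).card = GG m j 0 := by simp [GG]
  rw [h2]
  have := nar_aux m j
  rw [← h] at this
  exact_mod_cast this

theorem mem_map_perm {n : ℕ} (p : Equiv.Perm (Fin n)) (s : Finset (Fin n)) (x : Fin n) :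
    x ∈ s.map p.toEmbedding ↔ p.symm x ∈ s := Finset.mem_map_equiv

/-- number of larger entries to the right -/
def cod {n : ℕ} (p : Equiv.Perm (Fin n)) (i : Fin n) : ℕ :=
  (Finset.univ.filter fun j => i < j ∧ p i < p j).card

theorem cod_inj {n : ℕ} (p q : Equiv.Perm (Fin n)) (h : cod p = cod q) : p = q := by
  have aux : ∀ (p q : Equiv.Perm (Fin n)) (i : Fin n), (∀ j < i, p j = q j) → p i < q i →
      cod q i < cod p i := by
    intro p q i hij hlt
    unfold cod
    rw [← Finset.card_map (s := Finset.univ.filter fun j => i < j ∧ q i < q j) q.toEmbedding,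
      ← Finset.card_map (s := Finset.univ.filter fun j => i < j ∧ p i < p j) p.toEmbedding]
    apply Finset.card_lt_card
    rw [Finset.ssubset_iff_of_subset]
    · refine ⟨q i, ?_, ?_⟩
      · simp only [mem_map_perm, Finset.mem_filter, Finset.mem_univ, true_and,
          Equiv.apply_symm_apply]
        refine ⟨?_, hlt⟩
        by_contra hcon
        rcases lt_or_eq_of_le (not_lt.1 hcon) with h1 | h1
        · have := hij _ h1
          rw [Equiv.apply_symm_apply] at this
          exact absurd (q.injective this) (ne_of_gt h1)
        · rw [Equiv.symm_apply_eq] at h1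
          exact absurd h1 (ne_of_gt hlt)
      · simp
    · intro x
      simp only [mem_map_perm, Finset.mem_filter, Finset.mem_univ, true_and,
          Equiv.apply_symm_apply]
      rintro ⟨h1, h2⟩
      refine ⟨?_, hlt.trans h2⟩
      by_contra hcon
      rcases lt_or_eq_of_le (not_lt.1 hcon) with h3 | h3
      · have := hij _ h3
        rw [Equiv.apply_symm_apply] at this
        have h4 : q.symm x = p.symm x := by rw [Equiv.symm_apply_eq]; exact this
        rw [h4] at h1
        exact absurd h1 (not_lt.2 h3.le)
      · rw [Equiv.symm_apply_eq] at h3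
        rw [h3] at h2
        exact absurd h2 (not_lt.2 hlt.le)
  ext i
  congr 1
  induction i using WellFoundedLT.induction with
  | ind i ih =>
    rcases lt_trichotomy (p i) (q i) with h1 | h1 | h1
    · have := aux p q i (fun j hj => ih j hj) h1
      rw [h] at this; simp at this
    · exact h1
    · have := aux q p i (fun j hj => (ih j hj).symm) h1
      rw [h] at this; simp at this

theorem cod_asc {n : ℕ} (p : Equiv.Perm (Fin n)) (hp : Avoids132 p) (i i' : Fin n)
    (hi : i.1 + 1 = i'.1) (h : p i < p i') : cod p i = cod p i' + 1 := by
  unfold cod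
  rw [← Finset.card_insert_of_notMem (a := i') (by simp)]
  congr 1
  ext j
  simp only [Finset.mem_filter, Finset.mem_univ, true_and, Finset.mem_insert]
  constructor
  · rintro ⟨h1, h2⟩
    by_cases hj : j = i'
    · exact Or.inl hj
    · right
      have h3 : i' < j := by
        rw [Fin.lt_def] at *
        have := fun h => hj (Fin.ext h)
        omega
      refine ⟨h3, ?_⟩
      by_contra hcon
      have : p j ≠ p i' := fun h => hj (p.injective h)
      exact hp i i' j (by rw [Fin.lt_def]; omega) h3 ⟨h2, lt_of_le_of_ne (not_lt.1 hcon) this⟩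
  · rintro (rfl | ⟨h1, h2⟩)
    · exact ⟨by rw [Fin.lt_def]; omega, h⟩
    · exact ⟨by rw [Fin.lt_def] at *; omega, h.trans h2⟩

theorem cod_des {n : ℕ} (p : Equiv.Perm (Fin n)) (i i' : Fin n)
    (hi : i.1 + 1 = i'.1) (h : p i' < p i) : cod p i ≤ cod p i' := by
  unfold cod
  apply Finset.card_le_card
  intro j
  simp only [Finset.mem_filter, Finset.mem_univ, true_and]
  rintro ⟨h1, h2⟩
  refine ⟨?_, h.trans h2⟩
  have : j ≠ i' := by
    rintro rfl
    exact absurd h (not_lt.2 h2.le)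
  have := fun h => this (Fin.ext h)
  rw [Fin.lt_def] at *
  omega

theorem val_of (l : List ℕ) (h1 : ∀ i (h : i + 1 < l.length), l[i] ≤ l[i + 1] + 1)
    (h2 : ∀ h : l ≠ [], l.getLast h = 0) : Val l := by
  fun_induction Val l with
  | case1 => trivial
  | case2 a => simpa using h2
  | case3 a b l ih =>
    refine ⟨by simpa using h1 0 (by simp), ih ?_ ?_⟩
    · intro i h
      exact h1 (i + 1) (by simpa using h)
    · intro h
      simpa using h2 (by simp)

theorem val_cod {n : ℕ} (p : Equiv.Perm (Fin n)) (hp : Avoids132 p) : Val (List.ofFn (cod p)) := by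
  apply val_of
  · intro i h
    simp only [List.length_ofFn] at h
    simp only [List.getElem_ofFn]
    rcases lt_trichotomy (p ⟨i, by omega⟩) (p ⟨i + 1, h⟩) with h1 | h1 | h1
    · exact (cod_asc p hp _ _ rfl h1).le
    · have := p.injective h1
      simp at this
    · have := cod_des p ⟨i, by omega⟩ ⟨i + 1, h⟩ rfl h1
      omega
  · intro h
    rw [List.getLast_eq_getElem]
    simp only [List.getElem_ofFn, List.length_ofFn]
    unfold cod
    rw [Finset.card_eq_zero, Finset.filter_eq_empty_iff]
    rintro j - ⟨h1, -⟩
    rw [Fin.lt_def] at h1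
    simp at h1
    omega

theorem wl_get (l : List ℕ) : ∀ i, (wl l)[i]? = some true ↔ 
    ∃ h : i + 1 < l.length, l[i] ≤ l[i + 1] := by
  fun_induction wl l with
  | case1 => simp
  | case2 a => simp
  | case3 a b l ih =>
    intro i
    cases i with
    | zero => simp
    | succ i => simp [ih i]

theorem mem_Des {n : ℕ} (p : Equiv.Perm (Fin n)) (hp : Avoids132 p) (i : ℕ) :
    i + 1 ∈ Des p ↔ (wl (List.ofFn (cod p)))[i]? = some true := by
  rw [wl_get]
  simp only [Des, Set.mem_ofPred_eq, List.length_ofFn, List.getElem_ofFn, Nat.add_sub_cancel]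
  constructor
  · rintro ⟨h, h1⟩
    exact ⟨h.2, cod_des p _ _ rfl h1⟩
  · rintro ⟨h, h1⟩
    refine ⟨⟨by omega, h⟩, ?_⟩
    by_contra hcon
    rcases lt_or_eq_of_le (not_lt.1 hcon) with h2 | h2
    · have := cod_asc p hp ⟨i, by omega⟩ ⟨i + 1, h⟩ rfl h2
      omega
    · have := p.injective h2
      simp at this

theorem zero_notMem_Des {n : ℕ} (p : Equiv.Perm (Fin n)) : 0 ∉ Des p := by
  rintro ⟨h, -⟩
  omega

/-- the tree of an avoiding permutation -/
noncomputable def tr {n : ℕ} (p : {p : Equiv.Perm (Fin n) // Avoids132 p}) : BT :=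
  (exists_tree _ (val_cod p.1 p.2)).choose

theorem enc_tr {n : ℕ} (p : {p : Equiv.Perm (Fin n) // Avoids132 p}) :
    (tr p).enc = List.ofFn (cod p.1) := (exists_tree _ (val_cod p.1 p.2)).choose_spec

theorem tr_inj {n : ℕ} : Function.Injective
    (tr : {p : Equiv.Perm (Fin n) // Avoids132 p} → BT) := by
  intro p q h
  have h1 := enc_tr p
  rw [h, enc_tr] at h1
  exact Subtype.ext (cod_inj _ _ (List.ofFn_injective h1).symm)

theorem size_tr {n : ℕ} (p : {p : Equiv.Perm (Fin n) // Avoids132 p}) : (tr p).size = n := by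
  rw [← BT.length_enc, enc_tr]; simp

theorem Des_lt {n : ℕ} (p q : {p : Equiv.Perm (Fin n) // Avoids132 p})
    (h : (tr p).cid = (tr q).cid) (hr : (tr p).rk < (tr q).rk) : Des p.1 ⊂ Des q.1 := by
  have hm : ∀ (p : {p : Equiv.Perm (Fin n) // Avoids132 p}) i,
      i + 1 ∈ Des p.1 ↔ (tr p).word[i]? = some true := by
    intro p i
    rw [mem_Des p.1 p.2, ← enc_tr, BT.wl_enc]
  have hF := (BT.cid_chain _ _ h hr.le).1
  rw [List.forall₂_iff_get] at hF
  obtain ⟨hlen, hF⟩ := hF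
  have hsub : Des p.1 ⊆ Des q.1 := by
    intro i hi
    rcases i with _ | i
    · exact absurd hi (zero_notMem_Des _)
    · rw [hm] at *
      rw [List.getElem?_eq_some_iff] at *
      obtain ⟨h1, h2⟩ := hi
      exact ⟨hlen ▸ h1, hF i h1 (hlen ▸ h1) h2⟩
  refine ⟨hsub, fun hsup => ?_⟩
  have he : Des p.1 = Des q.1 := Set.Subset.antisymm hsub hsup
  have : (tr p).word = (tr q).word := by
    apply List.ext_getElem hlen
    intro i h1 h2
    have a := hm p i
    rw [he, hm q i, List.getElem?_eq_getElem h1, List.getElem?_eq_getElem h2] at a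
    simp only [Option.some.injEq] at a
    exact (Bool.eq_iff_iff.2 a).symm
  rw [← BT.count_word, ← BT.count_word, this] at hr
  exact lt_irrefl _ hr

/-- trees of size m+1 -/
noncomputable def TS (m : ℕ) : Finset BT :=
  (SL m).preimage BT.enc (fun s _ t _ h => BT.enc_inj s t h)

theorem mem_TS0 (m : ℕ) (t : BT) : t ∈ TS m ↔ t.enc ∈ SL m := Finset.mem_preimage

theorem mem_TS (m : ℕ) (t : BT) : t ∈ TS m ↔ t.size = m + 1 := by
  rw [mem_TS0, mem_SL, BT.length_enc]
  exact ⟨fun h => h.2, fun h => ⟨val_enc t, h⟩⟩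

open Classical in
theorem card_TS (m j : ℕ) : (m + 1) * ((TS m).filter fun t => t.rk = j).card =
    (m + 1).choose j * (m + 1).choose (j + 1) := by
  rw [← card_SL]
  congr 1
  apply Finset.card_bij (fun t _ => t.enc)
  · intro t ht
    simp only [Finset.mem_filter, mem_TS0] at *
    rwa [BT.lrk_enc]
  · intro s _ t _ h
    exact BT.enc_inj s t h
  · intro l hl
    simp only [Finset.mem_filter] at hl
    obtain ⟨t, rfl⟩ := exists_tree l ((mem_SL _ _).1 hl.1).1
    refine ⟨t, ?_, rfl⟩
    simp only [Finset.mem_filter, mem_TS0]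
    rwa [BT.lrk_enc] at hl

open Classical in
/-- The core bound: a set of trees meeting each chain at most `k` times. -/
theorem core (m k : ℕ) (hk : k ≤ m + 1) (B : Finset BT) (hB : ∀ t ∈ B, t.size = m + 1)
    (hc : ∀ c, (B.filter fun t => t.cid = c).card ≤ k) :
    B.card ≤ ((TS m).filter fun t =>
      t.rk ∈ Finset.Ico ((m + 1 - k) / 2) ((m + 1 - k) / 2 + k)).card := by
  set a := (m + 1 - k) / 2 with ha
  set R := (TS m).filter fun t => t.rk ∈ Finset.Ico a (a + k) with hR
  rw [Finset.card_eq_sum_card_fiberwise (f := BT.cid) (s := B) (t := B.image BT.cid)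
    (fun t ht => Finset.mem_coe.2 (Finset.mem_image_of_mem _ ht))]
  calc _ ≤ ∑ c ∈ B.image BT.cid, (R.filter fun t => t.cid = c).card := ?_
    _ ≤ R.card := by
      rw [← Finset.card_biUnion]
      · apply Finset.card_le_card
        intro t
        simp only [Finset.mem_biUnion, Finset.mem_filter]
        rintro ⟨c, _, h, _⟩
        exact h
      · intro c _ d _ hcd
        rw [Function.onFun, Finset.disjoint_left]
        intro t h1 h2
        simp only [Finset.mem_filter] at h1 h2
        exact hcd (h1.2.symm.trans h2.2)
  apply Finset.sum_le_sum
  intro c hcB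
  obtain ⟨x, hx, rfl⟩ := Finset.mem_image.1 hcB
  have hsx := hB x hx
  have hxl : x ≠ .leaf := by rintro rfl; simp [BT.size] at hsx
  have hrx := BT.cid_range x hxl
  set r := x.cid.bot with hr
  have hrange : ∀ y : BT, y.cid = x.cid → r ≤ y.rk ∧ y.rk + r ≤ m := by
    intro y hy
    have := BT.cid_range y (BT.cid_ne_leaf hxl hy)
    have hs : y.size = x.size := by rw [← BT.csize_cid, ← BT.csize_cid, hy]
    rw [hy] at this
    omega
  have h1 : (B.filter fun t => t.cid = x.cid).card ≤ (Finset.Icc r (m - r)).card := by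
    apply Finset.card_le_card_of_injOn BT.rk
    · intro y hy
      simp only [Finset.coe_filter, Set.mem_ofPred_eq] at hy
      have := hrange y hy.2
      simp only [Finset.coe_Icc, Set.mem_Icc]
      omega
    · intro y hy z hz hyz
      simp only [Finset.coe_filter, Set.mem_ofPred_eq] at hy hz
      exact (BT.cid_chain y z (hy.2.trans hz.2.symm) hyz.le).2 hyz
  have h2 := hc x.cid
  have h3 : (Finset.Icc (max r a) (min (m - r) (a + k - 1))).card ≤
      (R.filter fun t => t.cid = x.cid).card := by
    refine le_trans (Finset.card_le_card ?_) (Finset.card_image_le (f := BT.rk))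
    intro j hj
    rw [Finset.mem_Icc] at hj
    obtain ⟨y, hy, hyj⟩ := BT.cid_full x hxl j (by omega) (by omega)
    rw [Finset.mem_image]
    refine ⟨y, ?_, hyj⟩
    have hs : y.size = x.size := by rw [← BT.csize_cid, ← BT.csize_cid, hy]
    simp only [hR, Finset.mem_filter, mem_TS, Finset.mem_Ico]
    have hk0 : 0 < k := by
      refine lt_of_lt_of_le (Finset.card_pos.2 ⟨x, ?_⟩) h2
      simp [hx]
    refine ⟨⟨by omega, by omega, by omega⟩, hy⟩
  refine le_trans ?_ h3
  rw [Nat.card_Icc] at *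
  have := Finset.card_pos.2 ⟨x, (by simp [hx] : x ∈ B.filter fun t => t.cid = x.cid)⟩
  omega

/-- The poset `P^A_n` of 132-avoiding permutations of `[n]`, ordered by
`p ≤ q` iff `p = q` or `Des p ⊊ Des q`, is strongly Sperner: for any `k`
antichains `A_1, …, A_k`, `n` times the size of their union is at most the
maximum over `k`-element subsets `T` of `{0, …, n-1}` of
`∑_{j ∈ T} C(n,j) * C(n,j+1)` (witnessed here by some such `T`). -/
theorem stmt4 (n k : ℕ) (hn : 1 ≤ n) (hk : 1 ≤ k) (hkn : k ≤ n)
    (A : Fin k → Set {p : Equiv.Perm (Fin n) // Avoids132 p})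
    (hA : ∀ j, IsAntichain (fun p q => Des p.1 ⊂ Des q.1) (A j)) :
    ∃ T : Finset ℕ, T ⊆ Finset.range n ∧ T.card = k ∧
      n * (⋃ j, A j).ncard ≤ ∑ j ∈ T, n.choose j * n.choose (j + 1) := by
  classical
  obtain ⟨m, rfl⟩ : ∃ m, n = m + 1 := ⟨n - 1, by omega⟩
  set a := (m + 1 - k) / 2 with ha
  refine ⟨Finset.Ico a (a + k), ?_, by simp, ?_⟩
  · intro j hj
    simp only [Finset.mem_Ico, Finset.mem_range] at *
    omega
  have hfin : (⋃ j, A j).Finite := Set.toFinite _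
  set B : Finset BT := hfin.toFinset.image tr with hBdef
  have hcard : (⋃ j, A j).ncard = B.card := by
    rw [hBdef, Finset.card_image_of_injective _ tr_inj, Set.ncard_eq_toFinset_card _ hfin]
  have hmem : ∀ t ∈ B, ∃ p, (∃ j, p ∈ A j) ∧ tr p = t := by
    intro t ht
    simpa [hBdef] using ht
  have hcore := core m k hkn B (by
      intro t ht
      obtain ⟨p, _, rfl⟩ := hmem t ht
      exact size_tr p) (by
      intro c
      have hch : ∀ t : BT, ∃ j : Fin k, t ∈ B → ∃ p ∈ A j, tr p = t := by
        intro t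
        by_cases ht : t ∈ B
        · obtain ⟨p, ⟨j, hj⟩, hp⟩ := hmem t ht
          exact ⟨j, fun _ => ⟨p, hj, hp⟩⟩
        · exact ⟨⟨0, by omega⟩, fun h => absurd h ht⟩
      choose f hf using hch
      have := Finset.card_le_card_of_injOn (s := B.filter fun t => t.cid = c)
        (t := (Finset.univ : Finset (Fin k))) f (by intro t _; simp) (by
          intro s hs t ht hst
          simp only [Finset.coe_filter, Set.mem_ofPred_eq] at hs ht
          obtain ⟨p, hp, rfl⟩ := hf s hs.1
          obtain ⟨q, hq, rfl⟩ := hf t ht.1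
          rw [← hst] at hq
          by_contra hne
          have hpq : p ≠ q := fun h => hne (by rw [h])
          have hcc := hs.2.trans ht.2.symm
          rcases lt_trichotomy (tr p).rk (tr q).rk with h | h | h
          · exact hA _ hp hq hpq (Des_lt p q hcc h)
          · exact hne ((BT.cid_chain _ _ hcc h.le).2 h)
          · exact hA _ hq hp hpq.symm (Des_lt q p hcc.symm h))
      simpa using this)
  rw [hcard]
  calc (m + 1) * B.card ≤ (m + 1) * _ := Nat.mul_le_mul_left _ hcore
    _ = _ := by
      rw [Finset.card_eq_sum_card_fiberwise (f := BT.rk) (t := Finset.Ico a (a + k)), Finset.mul_sum]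
      · apply Finset.sum_congr rfl
        intro j hj
        rw [← card_TS, Finset.filter_filter]
        congr 2
        apply Finset.filter_congr
        intro t _
        constructor
        · exact fun h => h.2
        · rintro rfl; exact ⟨hj, rfl⟩
      · intro t ht
        simp only [Finset.coe_filter, Set.mem_ofPred_eq] at ht
        exact Finset.mem_coe.2 ht.2
end

section
/- For every n ≥ 1 and every subset S ⊆ [n−1], the number of 132-avoiding permutations of [n] with descent set exactly S equals the number of 132-avoiding permutations of [n] with descent set exactly α(S), where α(S) = {i ∈ [n−1] : n−i ∉ S} is the reverse complement of S. -/
/-- The reverse complement `α(S) = {i ∈ [n-1] : n - i ∉ S}` of `S ⊆ [n-1]`. -/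
def revCompl (n : ℕ) (S : Set ℕ) : Set ℕ :=
  {i | 1 ≤ i ∧ i ≤ n - 1 ∧ n - i ∉ S}

/-- The order used to mirror the decreasing binary tree of `p`. -/
def mprec {n : ℕ} (p : Equiv.Perm (Fin n)) (i j : Fin n) : Prop :=
  (i < j ∧ ∃ l, i < l ∧ l ≤ j ∧ p i < p l) ∨ (j < i ∧ ∀ k, j < k → k ≤ i → p k < p j)

lemma mprec_irrefl {n : ℕ} (p : Equiv.Perm (Fin n)) (i : Fin n) : ¬ mprec p i i := by
  simp [mprec]

lemma mprec_total {n : ℕ} (p : Equiv.Perm (Fin n)) {i j : Fin n} (h : i ≠ j) :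
    mprec p i j ∨ mprec p j i := by
  wlog hij : i < j generalizing i j
  · exact (this h.symm (lt_of_le_of_ne (not_lt.1 hij) h.symm)).symm
  by_cases hl : ∃ l, i < l ∧ l ≤ j ∧ p i < p l
  · exact Or.inl (Or.inl ⟨hij, hl⟩)
  · refine Or.inr (Or.inr ⟨hij, fun k hk hkj => ?_⟩)
    push Not at hl
    exact lt_of_le_of_ne (hl k hk hkj) (fun e => hk.ne' (p.injective e))

lemma mprec_asymm {n : ℕ} (p : Equiv.Perm (Fin n)) {i j : Fin n} (h : mprec p i j) :
    ¬ mprec p j i := by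
  rintro h'
  rcases h with ⟨h1, l, h2, h3, h4⟩ | ⟨h1, h2⟩ <;> rcases h' with ⟨g1, l', g2, g3, g4⟩ | ⟨g1, g2⟩
  · exact absurd h1 g1.not_gt
  · exact absurd h4 (g2 l h2 h3).not_gt
  · exact absurd g4 (h2 l' g2 g3).not_gt
  · exact absurd h1 g1.not_gt

lemma mprec_trans {n : ℕ} (p : Equiv.Perm (Fin n)) {i j k : Fin n} (h : mprec p i j)
    (h' : mprec p j k) : mprec p i k := by
  rcases h with ⟨h1, l, h2, h3, h4⟩ | ⟨h1, h2⟩ <;> rcases h' with ⟨g1, l', g2, g3, g4⟩ | ⟨g1, g2⟩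
  · exact Or.inl ⟨h1.trans g1, l, h2, h3.trans g1.le, h4⟩
  · rcases lt_trichotomy i k with hik | rfl | hik
    · refine Or.inl ⟨hik, ?_⟩
      rcases le_or_gt l k with hl | hl
      · exact ⟨l, h2, hl, h4⟩
      · exact ⟨k, hik, le_rfl, h4.trans (g2 l hl h3)⟩
    · exact absurd h4 (g2 l h2 h3).not_gt
    · exact Or.inr ⟨hik, fun m hm hmi => g2 m hm (hmi.trans h1.le)⟩
  · rcases lt_trichotomy i k with hik | rfl | hik
    · refine Or.inl ⟨hik, ?_⟩
      have hl : i < l' := by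
        by_contra hc
        exact absurd g4 (h2 l' g2 (not_lt.1 hc)).not_gt
      exact ⟨l', hl, g3, (h2 i h1 le_rfl).trans g4⟩
    · exact absurd g4 (h2 l' g2 g3).not_gt
    · exact absurd g4 (h2 l' g2 (g3.trans hik.le)).not_gt
  · refine Or.inr ⟨g1.trans h1, fun m hm hmi => ?_⟩
    rcases le_or_gt m j with hj | hj
    · exact g2 m hm hj
    · exact (h2 m hj hmi).trans (g2 j g1 le_rfl)

lemma exists_mirror {n : ℕ} (p : Equiv.Perm (Fin n)) :
    ∃ q : Equiv.Perm (Fin n), ∀ i j, q i < q j ↔ mprec p i.rev j.rev := by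
  classical
  let s : Fin n → Finset (Fin n) := fun i => Finset.univ.filter (fun j => mprec p j i)
  have hlt : ∀ i, (s i).card < n := by
    intro i
    have : (s i).card < (Finset.univ : Finset (Fin n)).card := by
      apply Finset.card_lt_card
      refine Finset.ssubset_univ_iff.2 (fun h => ?_)
      have : i ∈ s i := by rw [h]; simp
      exact mprec_irrefl p i (by simpa [s] using this)
    simpa using this
  have hmono : ∀ i j, mprec p i j → (s i).card < (s j).card := by
    intro i j h
    apply Finset.card_lt_card
    refine (Finset.ssubset_iff_of_subset ?_).2 ⟨i, by simpa [s] using h, by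
      simpa [s] using mprec_irrefl p i⟩
    intro k hk
    simp only [s, Finset.mem_filter, Finset.mem_univ, true_and] at hk ⊢
    exact mprec_trans p hk h
  let f : Fin n → Fin n := fun i => ⟨(s i.rev).card, hlt _⟩
  have hf : Function.Injective f := by
    intro i j h
    by_contra hne
    have e : (s i.rev).card = (s j.rev).card := congrArg Fin.val h
    rcases mprec_total p (fun h => hne (Fin.rev_injective h) : i.rev ≠ j.rev) with h1 | h1
    · exact (hmono _ _ h1).ne e
    · exact (hmono _ _ h1).ne' e
  refine ⟨Equiv.ofBijective f (Finite.injective_iff_bijective.1 hf), fun i j => ?_⟩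
  change (s i.rev).card < (s j.rev).card ↔ _
  refine ⟨fun h => ?_, hmono _ _⟩
  have hne : i.rev ≠ j.rev := by
    intro e; rw [e] at h; exact lt_irrefl _ h
  rcases mprec_total p hne with h1 | h1
  · exact h1
  · exact absurd h (hmono _ _ h1).not_gt

noncomputable def mirror {n : ℕ} (p : Equiv.Perm (Fin n)) : Equiv.Perm (Fin n) :=
  (exists_mirror p).choose

lemma mirror_spec {n : ℕ} (p : Equiv.Perm (Fin n)) (i j : Fin n) :
    mirror p i < mirror p j ↔ mprec p i.rev j.rev := (exists_mirror p).choose_spec i j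

lemma mirror_avoids {n : ℕ} (p : Equiv.Perm (Fin n)) : Avoids132 (mirror p) := by
  rintro a b c hab hbc ⟨h1, h2⟩
  rw [mirror_spec] at h1 h2
  have hab' : b.rev < a.rev := Fin.rev_lt_rev.2 hab
  have hbc' : c.rev < b.rev := Fin.rev_lt_rev.2 hbc
  rcases h1 with ⟨g, _⟩ | ⟨_, g⟩
  · exact absurd g (hbc'.trans hab').not_gt
  · exact mprec_asymm p h2 (Or.inr ⟨hbc', fun k hk hk' => g k hk (hk'.trans hab'.le)⟩)

lemma lt_iff_mprec {n : ℕ} {p : Equiv.Perm (Fin n)} (hp : Avoids132 p) {i j : Fin n}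
    (hij : i < j) : p i < p j ↔ ∀ k, i ≤ k → k < j → mprec p k j := by
  constructor
  · intro h k hk hkj
    refine Or.inl ⟨hkj, j, hkj, le_rfl, ?_⟩
    rcases hk.eq_or_lt with rfl | hk
    · exact h
    · by_contra hc
      exact hp i k j hk hkj ⟨h, lt_of_le_of_ne (not_lt.1 hc) (fun e => hkj.ne' (p.injective e))⟩
  · intro h
    obtain ⟨k, hk, hmax⟩ := Finset.exists_max_image (Finset.Ico i j) p ⟨i, by simp [hij]⟩
    rw [Finset.mem_Ico] at hk
    rcases h k hk.1 hk.2 with ⟨_, l, h1, h2, h3⟩ | ⟨g, _⟩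
    · rcases h2.eq_or_lt with rfl | h2
      · exact (hmax i (by simp [hij])).trans_lt h3
      · exact absurd h3 (hmax l (Finset.mem_Ico.2 ⟨hk.1.trans h1.le, h2⟩)).not_gt
    · exact absurd g hk.2.not_gt

lemma mirror_inj {n : ℕ} {p q : Equiv.Perm (Fin n)} (hp : Avoids132 p) (hq : Avoids132 q)
    (h : mirror p = mirror q) : p = q := by
  have hm : ∀ i j, mprec p i j ↔ mprec q i j := by
    intro i j
    have h1 := mirror_spec p i.rev j.rev
    have h2 := mirror_spec q i.rev j.rev
    rw [h] at h1
    simpa using h1.symm.trans h2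
  have hlt : ∀ i j, i < j → (p i < p j ↔ q i < q j) := by
    intro i j hij
    rw [lt_iff_mprec hp hij, lt_iff_mprec hq hij]
    simp only [hm]
  have hlt' : ∀ i j, p i < p j → q i < q j := by
    intro i j h
    rcases lt_trichotomy i j with hij | rfl | hij
    · exact (hlt i j hij).1 h
    · exact absurd h (lt_irrefl _)
    · by_contra hc
      exact absurd ((hlt j i hij).2 (lt_of_le_of_ne (not_lt.1 hc)
        (fun e => hij.ne (q.injective e)))) h.not_gt
  have hs : StrictMono (fun x => q (p.symm x)) := by
    intro x y hxy
    exact hlt' _ _ (by simpa using hxy)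
  have hid : (fun x => q (p.symm x)) = id := by
    apply StrictMono.range_inj hs strictMono_id |>.1
    rw [Set.range_id]
    exact (q.surjective.comp p.symm.surjective).range_eq
  ext1 i
  have := congrFun hid (p i)
  simpa using this.symm

lemma mirror_des {n : ℕ} (p : Equiv.Perm (Fin n)) : Des (mirror p) = revCompl n (Des p) := by
  ext i
  simp only [Des, revCompl, Set.mem_setOf_eq]
  by_cases hi : 1 ≤ i ∧ i < n
  swap
  · constructor
    · rintro ⟨h, _⟩; exact absurd h hi
    · rintro ⟨h1, h2, _⟩; omega
  have hr1 : (⟨i, hi.2⟩ : Fin n).rev = ⟨n - i - 1, by omega⟩ := by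
    ext; simp [Fin.val_rev]; omega
  have hr2 : (⟨i - 1, by omega⟩ : Fin n).rev = ⟨n - i, by omega⟩ := by
    ext; simp [Fin.val_rev]; omega
  have key : (mirror p ⟨i, hi.2⟩ < mirror p ⟨i - 1, by omega⟩) ↔
      p ⟨n - i - 1, by omega⟩ < p ⟨n - i, by omega⟩ := by
    rw [mirror_spec, hr1, hr2]
    constructor
    · rintro (⟨_, l, h1, h2, h3⟩ | ⟨g, _⟩)
      · have : l = ⟨n - i, by omega⟩ := by
          ext
          rw [Fin.lt_def] at h1
          rw [Fin.le_def] at h2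
          simp only at h1 h2 ⊢
          omega
        rwa [this] at h3
      · rw [Fin.lt_def] at g
        simp only at g
        omega
    · intro h
      have : (⟨n - i - 1, by omega⟩ : Fin n) < ⟨n - i, by omega⟩ := by
        rw [Fin.lt_def]; simp only; omega
      exact Or.inl ⟨this, _, this, le_rfl, h⟩
  constructor
  · rintro ⟨_, h⟩
    refine ⟨hi.1, by omega, ?_⟩
    rintro ⟨_, h'⟩
    exact absurd (key.1 h) h'.not_gt
  · rintro ⟨_, _, h⟩
    refine ⟨hi, key.2 ?_⟩
    by_contra hc
    refine h ⟨by omega, lt_of_le_of_ne (not_lt.1 hc) (fun e => ?_)⟩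
    have := congrArg Fin.val (p.injective e)
    simp only at this
    omega

lemma card_le_mirror (n : ℕ) (S : Set ℕ) :
    Nat.card {p : Equiv.Perm (Fin n) // Avoids132 p ∧ Des p = S} ≤
      Nat.card {p : Equiv.Perm (Fin n) // Avoids132 p ∧ Des p = revCompl n S} := by
  refine Nat.card_le_card_of_injective
    (fun p => ⟨mirror p.1, mirror_avoids p.1, by rw [mirror_des, p.2.2]⟩) ?_
  intro p q h
  exact Subtype.ext (mirror_inj p.2.1 q.2.1 (congrArg Subtype.val h))

/-- The number of 132-avoiding permutations of `[n]` with descent set exactly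
`S` equals the number with descent set exactly `α(S)`. -/
theorem stmt5 (n : ℕ) (hn : 1 ≤ n) (S : Set ℕ) (hS : S ⊆ Set.Icc 1 (n - 1)) :
    Nat.card {p : Equiv.Perm (Fin n) // Avoids132 p ∧ Des p = S} =
      Nat.card {p : Equiv.Perm (Fin n) // Avoids132 p ∧ Des p = revCompl n S} := by
  refine le_antisymm (card_le_mirror n S) ?_
  have h := card_le_mirror n (revCompl n S)
  have e : revCompl n (revCompl n S) = S := by
    ext i
    simp only [revCompl, Set.mem_setOf_eq]
    constructor
    · rintro ⟨h1, h2, h3⟩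
      by_contra hc
      refine h3 ⟨by omega, by omega, ?_⟩
      rwa [show n - (n - i) = i by omega]
    · intro hi
      obtain ⟨h1, h2⟩ := hS hi
      refine ⟨h1, h2, ?_⟩
      rintro ⟨_, _, h3⟩
      rw [show n - (n - i) = i by omega] at h3
      exact h3 hi
  rwa [e] at h
end

section
/- For every n ≥ 1 and every subset S ⊆ [n−1], the number of 321-avoiding permutations of [n] whose excedence set is exactly S equals the number of 132-avoiding permutations of [n] whose descent set is exactly α(S), where α(S) = {i ∈ [n−1] : n−i ∉ S}. -/
/-- A permutation `p` of `[n]` (0-based `Fin n`) is 321-avoiding if there are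
no positions `a < b < c` with `p a > p b > p c`. -/
def Avoids321 {n : ℕ} (p : Equiv.Perm (Fin n)) : Prop :=
  ∀ a b c : Fin n, a < b → b < c → ¬ (p b < p a ∧ p c < p b)

/-- The excedence set of `p`, as a set of 1-based positions `i ∈ [n]` with
`p(i) > i`, i.e. (0-based) `(p ⟨i-1⟩ : ℕ) > i - 1`. -/
def Exc {n : ℕ} (p : Equiv.Perm (Fin n)) : Set ℕ :=
  {i | ∃ h : 1 ≤ i ∧ i ≤ n,
        (i - 1 : ℕ) <
          (p ⟨i - 1, Nat.lt_of_lt_of_le (Nat.sub_lt h.1 Nat.one_pos) h.2⟩ : ℕ)}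

namespace Stmt9

variable {n : ℕ}

/-- suffix minimum -/
def G (p : Equiv.Perm (Fin n)) (i : Fin n) : Fin n :=
  (Finset.Ici i).inf' ⟨i, by simp⟩ (fun j => p j)

lemma G_le (p : Equiv.Perm (Fin n)) {i j : Fin n} (h : i ≤ j) : G p i ≤ p j :=
  Finset.inf'_le _ (by simpa using h)

lemma le_G (p : Equiv.Perm (Fin n)) {i v : Fin n} (h : ∀ j, i ≤ j → v ≤ p j) : v ≤ G p i :=
  Finset.le_inf' _ _ (fun j hj => h j (by simpa using hj))

lemma G_mono (p : Equiv.Perm (Fin n)) : Monotone (G p) := fun _ _ hab =>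
  le_G p (fun _ hj => G_le p (hab.trans hj))

lemma G_exists (p : Equiv.Perm (Fin n)) (i : Fin n) : ∃ j, i ≤ j ∧ G p i = p j := by
  obtain ⟨j, hj, h⟩ := Finset.exists_mem_eq_inf' (s := Finset.Ici i) ⟨i, by simp⟩ (fun j => p j)
  exact ⟨j, by simpa using hj, h⟩

lemma pig (p : Equiv.Perm (Fin n)) (i : Fin n) : ∃ j, i ≤ j ∧ p j ≤ i := by
  by_contra! hc
  have h : ((Finset.Ici i).image p).card ≤ (Finset.Ioi i).card := by
    apply Finset.card_le_card
    intro v hv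
    simp only [Finset.mem_image, Finset.mem_Ici, Finset.mem_Ioi] at hv ⊢
    obtain ⟨j, hj, rfl⟩ := hv
    exact hc j hj
  rw [Finset.card_image_of_injective _ p.injective] at h
  simp at h
  omega

lemma G_le_self (p : Equiv.Perm (Fin n)) (i : Fin n) : G p i ≤ i := by
  obtain ⟨j, hj, h⟩ := pig p i
  exact (G_le p hj).trans h

lemma pig2 (p : Equiv.Perm (Fin n)) {i j : Fin n} (hij : i < j) (hj : p j ≤ i) :
    ∃ a, a ≤ i ∧ i < p a := by
  by_contra! hc
  have h : ((insert j (Finset.Iic i)).image p).card ≤ (Finset.Iic i).card := by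
    apply Finset.card_le_card
    intro v hv
    simp only [Finset.mem_image, Finset.mem_insert, Finset.mem_Iic] at hv ⊢
    obtain ⟨k, hk | hk, rfl⟩ := hv
    · exact hk ▸ hj
    · exact hc k hk
  rw [Finset.card_image_of_injective _ p.injective,
    Finset.card_insert_of_notMem (by simpa using hij)] at h
  omega

lemma nonexc_lt {p : Equiv.Perm (Fin n)} (hp : Avoids321 p) {i j : Fin n} (hi : p i ≤ i)
    (hij : i < j) : p i < p j := by
  by_contra! hc
  have hne : p j ≠ p i := fun h => hij.ne' (p.injective h)
  have hlt : p j < p i := lt_of_le_of_ne hc hne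
  obtain ⟨a, ha, ha'⟩ := pig2 p hij (hlt.le.trans hi)
  have : a ≠ i := by rintro rfl; exact absurd hi (not_le.mpr ha')
  exact hp a i j (lt_of_le_of_ne ha this) hij ⟨hi.trans_lt ha', hlt⟩

lemma exc_exists {p : Equiv.Perm (Fin n)} {i : Fin n} (hi : i < p i) :
    ∃ j, i < j ∧ p j < p i := by
  obtain ⟨j, hj, h⟩ := pig p i
  refine ⟨j, lt_of_le_of_ne hj ?_, h.trans_lt hi⟩
  rintro rfl
  exact absurd h (not_le.mpr hi)

lemma G_eq_of_nonexc {p : Equiv.Perm (Fin n)} (hp : Avoids321 p) {i : Fin n} (hi : p i ≤ i) :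
    G p i = p i := by
  apply le_antisymm (G_le p le_rfl)
  apply le_G
  intro j hj
  rcases hj.eq_or_lt with rfl | hj
  · exact le_rfl
  · exact (nonexc_lt hp hi hj).le

lemma exc_iff {p : Equiv.Perm (Fin n)} (hp : Avoids321 p) (i : ℕ) (h : i + 1 < n) :
    (⟨i, by omega⟩ : Fin n) < p ⟨i, by omega⟩ ↔ G p ⟨i, by omega⟩ = G p ⟨i + 1, h⟩ := by
  constructor
  · intro hi
    apply le_antisymm (G_mono p (by simp))
    obtain ⟨j, hj, hG⟩ := G_exists p ⟨i, by omega⟩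
    rw [hG]
    apply G_le
    have : j ≠ ⟨i, by omega⟩ := by
      intro hji
      rw [hji] at hG
      obtain ⟨k, hk, hk'⟩ := exc_exists hi
      have := G_le p hk.le
      rw [hG] at this
      exact absurd this (not_le.mpr hk')
    have h2 : (j : ℕ) ≠ i := fun h => this (Fin.ext h)
    rw [Fin.le_def] at hj ⊢
    simp only at hj ⊢
    omega
  · intro hG
    by_contra! hi
    obtain ⟨j, hj, hj'⟩ := G_exists p ⟨i + 1, h⟩
    have h3 : (⟨i, by omega⟩ : Fin n) < j := by
      rw [Fin.le_def] at hj; rw [Fin.lt_def]; simp only at hj ⊢; omega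
    have := nonexc_lt hp hi h3
    rw [← hj', ← hG, G_eq_of_nonexc hp hi] at this
    exact lt_irrefl _ this

lemma exc_lt {p : Equiv.Perm (Fin n)} {i : Fin n} (hi : i < p i) : (i : ℕ) + 1 < n := by
  have := (p i).2
  rw [Fin.lt_def] at hi
  omega

lemma G_inj_exc {p q : Equiv.Perm (Fin n)} (hp : Avoids321 p) (hq : Avoids321 q)
    (h : G p = G q) (i : Fin n) (hi : i < p i) : i < q i := by
  have h1 := exc_lt hi
  have := exc_iff hp i h1
  have h2 := exc_iff hq i h1
  rw [h] at this
  exact h2.mpr (this.mp hi)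

lemma exc_mono {p : Equiv.Perm (Fin n)} (hp : Avoids321 p) {i j : Fin n}
    (hj : j < p j) (hij : i < j) : p i < p j := by
  by_contra! hc
  have hne : p j ≠ p i := fun h => hij.ne' (p.injective h)
  have hlt : p j < p i := lt_of_le_of_ne hc hne
  obtain ⟨k, hk, hk'⟩ := exc_exists hj
  exact hp i j k hij hk ⟨hlt, hk'⟩

lemma G_inj {p q : Equiv.Perm (Fin n)} (hp : Avoids321 p) (hq : Avoids321 q)
    (h : G p = G q) : p = q := by
  have hE : ∀ i, i < p i ↔ i < q i := fun i => ⟨G_inj_exc hp hq h i, G_inj_exc hq hp h.symm i⟩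
  have hN : ∀ i, ¬ i < p i → p i = q i := by
    intro i hi
    rw [← G_eq_of_nonexc hp (not_lt.mp hi), h, G_eq_of_nonexc hq (not_lt.mp ((hE i).not.mp hi))]
  let T := {i : Fin n // i < p i}
  have key : (fun i : T => p i.1) = (fun i : T => q i.1) := by
    have m1 : StrictMono (fun i : T => p i.1) := fun i j hij => exc_mono hp j.2 hij
    have m2 : StrictMono (fun i : T => q i.1) := fun i j hij => exc_mono hq ((hE _).mp j.2) hij
    rw [← StrictMono.range_inj m1 m2]
    ext v
    simp only [Set.mem_range]
    constructor
    · rintro ⟨i, rfl⟩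
      obtain ⟨k, hk⟩ := q.surjective (p i)
      refine ⟨⟨k, ?_⟩, hk⟩
      by_contra hc
      have := hN k hc
      rw [hk] at this
      exact hc (p.injective this ▸ i.2)
    · rintro ⟨i, rfl⟩
      obtain ⟨k, hk⟩ := p.surjective (q i)
      refine ⟨⟨k, ?_⟩, hk⟩
      by_contra hc
      have := hN k hc
      rw [hk] at this
      exact hc (q.injective this ▸ i.2)
  ext1 i
  by_cases hi : i < p i
  · exact congrFun key ⟨i, hi⟩
  · exact hN i hi

lemma exists_fill (T W : Finset (Fin n)) (h : T.card = W.card) :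
    ∃ f : Fin n → Fin n, StrictMonoOn f T ∧ ∀ i ∈ T, f i ∈ W := by
  classical
  let e := (T.orderIsoOfFin rfl).symm.trans (W.orderIsoOfFin h.symm)
  refine ⟨fun i => if hi : i ∈ T then (e ⟨i, hi⟩).1 else i, ?_, ?_⟩
  · intro i hi j hj hij
    have hi' : i ∈ T := hi
    have hj' : j ∈ T := hj
    simp only [hi', hj', dif_pos]
    exact e.strictMono (show (⟨i, hi'⟩ : T) < ⟨j, hj'⟩ from hij)
  · intro i hi
    simp only [hi, dif_pos]
    exact (e ⟨i, hi⟩).2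

lemma G_surj (g : Fin n → Fin n) (hm : Monotone g) (hg : ∀ i, g i ≤ i) :
    ∃ p : Equiv.Perm (Fin n), Avoids321 p ∧ G p = g := by
  classical
  let T : Finset (Fin n) := Finset.univ.filter
    (fun i => ∃ h : (i : ℕ) + 1 < n, g i = g ⟨i + 1, h⟩)
  have hT : ∀ i, i ∈ T ↔ ∃ h : (i : ℕ) + 1 < n, g i = g ⟨i + 1, h⟩ := by simp [T]
  have hlt : ∀ i j, i ∉ T → i < j → g i < g j := by
    intro i j hi hij
    rw [hT] at hi
    push Not at hi
    have h1 : (i : ℕ) + 1 < n := by have := j.2; rw [Fin.lt_def] at hij; omega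
    have h2 : g i ≤ g ⟨i + 1, h1⟩ := hm (by rw [Fin.le_def]; simp)
    have h3 : g ⟨i + 1, h1⟩ ≤ g j := hm (by rw [Fin.le_def]; rw [Fin.lt_def] at hij; simpa using hij)
    exact (lt_of_le_of_ne h2 (hi h1)).trans_le h3
  have hinj : Set.InjOn g (Tᶜ : Finset (Fin n)) := by
    intro i hi j hj hij
    simp only [Finset.coe_compl, Set.mem_compl_iff, Finset.mem_coe] at hi hj
    rcases lt_trichotomy i j with h | h | h
    · exact absurd hij (hlt i j hi h).ne
    · exact h
    · exact absurd hij (hlt j i hj h).ne'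
  obtain ⟨f, hf, hfW⟩ := exists_fill T ((Tᶜ).image g)ᶜ (by
    rw [Finset.card_compl, Finset.card_image_of_injOn hinj, Finset.card_compl]
    have := Finset.card_le_univ T
    omega)
  have hfW' : ∀ i ∈ T, ∀ j, j ∉ T → f i ≠ g j := by
    intro i hi j hj h
    have := hfW i hi
    simp only [Finset.mem_compl, Finset.mem_image, not_exists, not_and] at this
    exact this j hj h.symm
  let p0 : Fin n → Fin n := fun i => if i ∈ T then f i else g i
  have hp0 : Function.Injective p0 := by
    intro i j hij
    by_cases hi : i ∈ T <;> by_cases hj : j ∈ T <;> simp only [p0, hi, hj, if_true, if_false] at hij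
    · exact hf.injOn hi hj hij
    · exact absurd hij (hfW' i hi j hj)
    · exact absurd hij.symm (hfW' j hj i hi)
    · exact hinj (by simpa using hi) (by simpa using hj) hij
  let p : Equiv.Perm (Fin n) := Equiv.ofBijective p0 (Finite.injective_iff_bijective.mp hp0)
  have hpT : ∀ i ∈ T, p i = f i := fun i hi => by simp [p, p0, hi]
  have hpN : ∀ i, i ∉ T → p i = g i := fun i hi => by simp [p, p0, hi]
  have hmT : ∀ i j, i ∈ T → j ∈ T → i < j → p i < p j := fun i j hi hj hij => by
    rw [hpT i hi, hpT j hj]; exact hf hi hj hij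
  have hmN : ∀ i j, i ∉ T → j ∉ T → i < j → p i < p j := fun i j hi hj hij => by
    rw [hpN i hi, hpN j hj]; exact hlt i j hi hij
  refine ⟨p, ?_, ?_⟩
  · rintro a b c hab hbc ⟨h1, h2⟩
    by_cases ha : a ∈ T <;> by_cases hb : b ∈ T <;> by_cases hc : c ∈ T <;>
    first
    | exact absurd h1 (hmT a b ha hb hab).asymm
    | exact absurd h1 (hmN a b ha hb hab).asymm
    | exact absurd h2 (hmT b c hb hc hbc).asymm
    | exact absurd h2 (hmN b c hb hc hbc).asymm
    | exact absurd (h2.trans h1) (hmT a c ha hc (hab.trans hbc)).asymm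
    | exact absurd (h2.trans h1) (hmN a c ha hc (hab.trans hbc)).asymm
  have hnext : ∀ k : ℕ, ∀ i : Fin n, n - (i : ℕ) = k → ∃ t, i ≤ t ∧ t ∉ T ∧ g t = g i := by
    intro k
    induction k with
    | zero => intro i hi; have := i.2; omega
    | succ k ih =>
      intro i hi
      by_cases h : i ∈ T
      · obtain ⟨h1, h2⟩ := (hT i).mp h
        obtain ⟨t, ht, ht', ht''⟩ := ih ⟨i + 1, h1⟩ (by simp only; omega)
        refine ⟨t, le_trans ?_ ht, ht', ht''.trans h2.symm⟩
        rw [Fin.le_def]; simp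
      · exact ⟨i, le_rfl, h, rfl⟩
  have hge : ∀ j, g j ≤ p j := by
    intro j
    by_cases hj : j ∈ T
    · by_contra! hc
      have h : ((Finset.Iic j).image p).card ≤ (Finset.Iio (g j)).card := by
        apply Finset.card_le_card
        intro v hv
        simp only [Finset.mem_image, Finset.mem_Iic, Finset.mem_Iio] at hv ⊢
        obtain ⟨k, hk, rfl⟩ := hv
        rcases hk.eq_or_lt with rfl | hk
        · exact hc
        by_cases hkT : k ∈ T
        · exact (hmT k j hkT hj hk).trans hc
        · rw [hpN k hkT]; exact hlt k j hkT hk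
      rw [Finset.card_image_of_injective _ p.injective] at h
      simp only [Fin.card_Iic, Fin.card_Iio] at h
      have := hg j
      rw [Fin.le_def] at this
      omega
    · rw [hpN j hj]
  funext i
  apply le_antisymm
  · obtain ⟨t, ht, ht', ht''⟩ := hnext _ i rfl
    rw [← ht'', ← hpN t ht']
    exact G_le p ht
  · exact le_G p (fun j hj => (hm hj).trans (hge j))

/-- Lehmer code -/
def C (p : Equiv.Perm (Fin n)) (i : Fin n) : ℕ :=
  (Finset.univ.filter (fun j => i < j ∧ p j < p i)).card

lemma C_eq (p : Equiv.Perm (Fin n)) (i : Fin n) :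
    C p i = (Finset.univ.filter (fun v => v < p i ∧ ∀ j < i, p j ≠ v)).card := by
  classical
  rw [C, ← Finset.card_image_of_injective _ p.injective]
  congr 1
  ext v
  simp only [Finset.mem_image, Finset.mem_filter, Finset.mem_univ, true_and]
  constructor
  · rintro ⟨j, ⟨h1, h2⟩, rfl⟩
    refine ⟨h2, fun k hk h => ?_⟩
    have := p.injective h
    subst this
    exact hk.asymm h1
  · rintro ⟨h1, h2⟩
    obtain ⟨j, rfl⟩ := p.surjective v
    refine ⟨j, ⟨?_, h1⟩, rfl⟩
    rcases lt_trichotomy i j with h | h | h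
    · exact h
    · subst h; exact absurd h1 (lt_irrefl _)
    · exact absurd rfl (h2 j h)

lemma C_step {p q : Equiv.Perm (Fin n)} {i : Fin n} (ih : ∀ j < i, p j = q j)
    (h : C p i = C q i) : ¬ p i < q i := by
  intro hlt
  rw [C_eq, C_eq] at h
  refine absurd h (Finset.card_lt_card ?_).ne
  rw [Finset.ssubset_iff_of_subset]
  · refine ⟨p i, ?_, by simp⟩
    simp only [Finset.mem_filter, Finset.mem_univ, true_and]
    refine ⟨hlt, fun j hj h => ?_⟩
    rw [← ih j hj] at h
    exact hj.ne (p.injective h)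
  · intro v
    simp only [Finset.mem_filter, Finset.mem_univ, true_and]
    rintro ⟨h1, h2⟩
    exact ⟨h1.trans hlt, fun j hj => ih j hj ▸ h2 j hj⟩

lemma C_inj {p q : Equiv.Perm (Fin n)} (h : C p = C q) : p = q := by
  ext1 i
  induction i using WellFoundedLT.induction with
  | ind i ih =>
    apply le_antisymm
    · exact not_lt.mp (C_step (fun j hj => (ih j hj).symm) (congrFun h.symm i))
    · exact not_lt.mp (C_step ih (congrFun h i))

lemma C_lt (p : Equiv.Perm (Fin n)) (i : Fin n) : C p i < n - i := by
  have h : C p i ≤ (Finset.Ioi i).card := by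
    apply Finset.card_le_card
    intro j hj
    simp only [Finset.mem_filter, Finset.mem_univ, true_and] at hj
    simpa using hj.1
  simp only [Fin.card_Ioi] at h
  have := i.2
  omega

lemma C_surj (c : Fin n → ℕ) (hc : ∀ i, c i < n - i) : ∃ p : Equiv.Perm (Fin n), C p = c := by
  let F : Equiv.Perm (Fin n) → (∀ i : Fin n, Fin (n - i)) := fun p i => ⟨C p i, C_lt p i⟩
  have hF : Function.Injective F := by
    intro p q h
    apply C_inj
    funext i
    exact congrArg Fin.val (congrFun h i)
  have hcard : Fintype.card (Equiv.Perm (Fin n)) = Fintype.card (∀ i : Fin n, Fin (n - i)) := by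
    rw [Fintype.card_perm, Fintype.card_pi]
    simp only [Fintype.card_fin]
    rw [Fin.prod_univ_eq_prod_range (fun i => n - i) n, ← Finset.prod_range_add_one_eq_factorial,
      ← Finset.prod_range_reflect]
    apply Finset.prod_congr rfl
    intro i hi
    have := Finset.mem_range.mp hi
    omega
  obtain ⟨p, hp⟩ := ((Fintype.bijective_iff_injective_and_card F).mpr ⟨hF, hcard⟩).2
    (fun i => ⟨c i, hc i⟩)
  refine ⟨p, ?_⟩
  funext i
  exact congrArg Fin.val (congrFun hp i)

lemma C_anti {p : Equiv.Perm (Fin n)} (hp : Avoids132 p) : Antitone (C p) := by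
  intro a b hab
  rcases hab.eq_or_lt with rfl | hab
  · exact le_rfl
  apply Finset.card_le_card
  intro j
  simp only [Finset.mem_filter, Finset.mem_univ, true_and]
  rintro ⟨h1, h2⟩
  refine ⟨hab.trans h1, ?_⟩
  by_contra! hc
  have hne : p a ≠ p j := fun h => (hab.trans h1).ne (p.injective h)
  exact hp a b j hab h1 ⟨lt_of_le_of_ne hc hne, h2⟩

lemma avoids_of_anti {p : Equiv.Perm (Fin n)} (hC : Antitone (C p)) : Avoids132 p := by
  rintro a0 b c hab0 hbc ⟨h1, h2⟩
  let A := Finset.univ.filter (fun a => a < b ∧ p a < p c)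
  have hA : A.Nonempty := ⟨a0, by simp [A, hab0, h1]⟩
  obtain ⟨a, ha, hmax⟩ := A.exists_max_image id hA
  simp only [A, Finset.mem_filter, Finset.mem_univ, true_and, id] at ha hmax
  obtain ⟨hab, hac⟩ := ha
  refine absurd (hC hab.le) (not_le.mpr (Finset.card_lt_card ?_))
  rw [Finset.ssubset_iff_of_subset]
  · refine ⟨c, by simp [hbc, h2], ?_⟩
    simp only [Finset.mem_filter, Finset.mem_univ, true_and, not_and, not_lt]
    exact fun _ => hac.le
  · intro j
    simp only [Finset.mem_filter, Finset.mem_univ, true_and]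
    rintro ⟨h3, h4⟩
    refine ⟨?_, h4.trans (hac.trans h2)⟩
    rcases lt_trichotomy b j with h | h | h
    · exact h
    · subst h; exact absurd (h4.trans (hac.trans h2)) (lt_irrefl _)
    · exact absurd (hmax j ⟨h, h4.trans hac⟩) (not_le.mpr h3)

lemma des_iff (p : Equiv.Perm (Fin n)) {i k : Fin n} (hik : (k : ℕ) = i + 1) :
    p k < p i ↔ C p k < C p i := by
  have hlt : i < k := by rw [Fin.lt_def]; omega
  constructor
  · intro h
    apply Finset.card_lt_card
    rw [Finset.ssubset_iff_of_subset]
    · exact ⟨k, by simp [hlt, h], by simp⟩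
    · intro j
      simp only [Finset.mem_filter, Finset.mem_univ, true_and]
      exact fun h' => ⟨hlt.trans h'.1, h'.2.trans h⟩
  · intro h
    by_contra! hc
    refine absurd h (not_lt.mpr (Finset.card_le_card ?_))
    intro j
    simp only [Finset.mem_filter, Finset.mem_univ, true_and]
    rintro ⟨h1, h2⟩
    refine ⟨?_, h2.trans_le hc⟩
    have : j ≠ k := by rintro rfl; exact absurd h2 (not_lt.mpr hc)
    have h3 : (j : ℕ) ≠ k := fun h => this (Fin.ext h)
    rw [Fin.lt_def] at h1 ⊢
    omega

/-- the middle objects -/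
def Mid (n : ℕ) (S : Set ℕ) (g : Fin n → Fin n) : Prop :=
  Monotone g ∧ (∀ i, g i ≤ i) ∧
    ∀ (i : ℕ) (h : i + 1 < n), i + 1 ∈ S ↔ g ⟨i, by omega⟩ = g ⟨i + 1, h⟩

lemma exc_eq_iff {p : Equiv.Perm (Fin n)} (hp : Avoids321 p) {S : Set ℕ}
    (hS : S ⊆ Set.Icc 1 (n - 1)) : Exc p = S ↔ Mid n S (G p) := by
  have hE : ∀ (i : ℕ) (h : i + 1 < n), i + 1 ∈ Exc p ↔ G p ⟨i, by omega⟩ = G p ⟨i + 1, h⟩ := by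
    intro i h
    rw [← exc_iff hp i h, Fin.lt_def]
    simp only [Exc, Set.mem_setOf_eq, Nat.add_sub_cancel]
    exact ⟨fun h => h.2, fun h' => ⟨⟨by omega, by omega⟩, h'⟩⟩
  constructor
  · rintro rfl
    exact ⟨G_mono p, G_le_self p, hE⟩
  · rintro ⟨-, -, h⟩
    ext i
    constructor
    · intro hi
      obtain ⟨⟨h1, h2⟩, h3⟩ := id hi
      obtain ⟨k, rfl⟩ : ∃ k, i = k + 1 := ⟨i - 1, by omega⟩
      have h4 : k + 1 < n := exc_lt (p := p) (i := ⟨k, by omega⟩) (by rw [Fin.lt_def]; exact h3)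
      rw [h k h4, ← hE k h4]; exact hi
    · intro hi
      have := hS hi
      rw [Set.mem_Icc] at this
      obtain ⟨k, rfl⟩ : ∃ k, i = k + 1 := ⟨i - 1, by omega⟩
      have h4 : k + 1 < n := by omega
      rw [hE k h4, ← h k h4]; exact hi

lemma card321 {S : Set ℕ} (hS : S ⊆ Set.Icc 1 (n - 1)) :
    Nat.card {p : Equiv.Perm (Fin n) // Avoids321 p ∧ Exc p = S} =
      Nat.card {g : Fin n → Fin n // Mid n S g} := by
  apply Nat.card_eq_of_bijective (fun p => ⟨G p.1, (exc_eq_iff p.2.1 hS).mp p.2.2⟩)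
  constructor
  · intro p q h
    exact Subtype.ext (G_inj p.2.1 q.2.1 (congrArg Subtype.val h))
  · rintro ⟨g, hg⟩
    obtain ⟨p, hp, hG⟩ := G_surj g hg.1 hg.2.1
    exact ⟨⟨p, hp, (exc_eq_iff hp hS).mpr (hG ▸ hg)⟩, Subtype.ext hG⟩

/-- reversed Lehmer code -/
def R (p : Equiv.Perm (Fin n)) (i : Fin n) : Fin n :=
  ⟨C p i.rev, (C_lt p i.rev).trans_le (Nat.sub_le _ _)⟩

lemma des_eq_iff {p : Equiv.Perm (Fin n)} (hp : Avoids132 p) {S : Set ℕ} :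
    Des p = revCompl n S ↔ Mid n S (R p) := by
  have hm : Monotone (R p) := fun a b hab => by
    rw [Fin.le_def]; exact C_anti hp (Fin.rev_le_rev.mpr hab)
  have hle : ∀ i, R p i ≤ i := fun i => by
    rw [Fin.le_def]
    have h1 := C_lt p i.rev
    have h2 := i.2
    rw [Fin.val_rev] at h1
    simp only [R]
    omega
  have hD : ∀ (i : ℕ) (h : i + 1 < n), n - (i + 1) ∉ Des p ↔ R p ⟨i, by omega⟩ = R p ⟨i + 1, h⟩ := by
    intro i h
    have h1 : R p ⟨i, by omega⟩ ≤ R p ⟨i + 1, h⟩ := hm (by simp)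
    have h2 : n - (i + 1) ∈ Des p ↔ R p ⟨i, by omega⟩ < R p ⟨i + 1, h⟩ := by
      have h3 := des_iff p (i := (⟨i + 1, h⟩ : Fin n).rev) (k := (⟨i, by omega⟩ : Fin n).rev)
        (by simp only [Fin.val_rev]; omega)
      have e1 : (⟨n - (i + 1), by omega⟩ : Fin n) = (⟨i, by omega⟩ : Fin n).rev := by
        ext; simp only [Fin.val_rev]
      have e2 : (⟨n - (i + 1) - 1, by omega⟩ : Fin n) = (⟨i + 1, h⟩ : Fin n).rev := by
        ext; simp only [Fin.val_rev]; omega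
      rw [Fin.lt_def]
      change _ ↔ C p _ < C p _
      rw [← h3, ← e1, ← e2]
      exact ⟨fun h => h.2, fun h' => ⟨⟨by omega, by omega⟩, h'⟩⟩
    rw [h2, not_lt]
    exact ⟨fun h => le_antisymm h1 h, fun h => h.ge⟩
  constructor
  · intro hE
    refine ⟨hm, hle, fun i h => ?_⟩
    rw [← hD i h, hE]
    have e : n - (n - (i + 1)) = i + 1 := by omega
    simp only [revCompl, Set.mem_setOf_eq, e]
    constructor
    · rintro h1 ⟨-, -, h2⟩; exact h2 h1
    · intro h1
      by_contra h2
      exact h1 ⟨by omega, by omega, h2⟩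
  · rintro ⟨-, -, hM⟩
    have key : ∀ d, 1 ≤ d → d < n → (d ∈ Des p ↔ n - d ∉ S) := by
      intro d h1 h2
      obtain ⟨i, hi⟩ : ∃ i, n - d = i + 1 := ⟨n - d - 1, by omega⟩
      have h3 := (hD i (by omega)).trans (hM i (by omega)).symm
      have e : n - (i + 1) = d := by omega
      rw [e, ← hi] at h3
      rw [← h3, not_not]
    ext d
    constructor
    · intro hd
      obtain ⟨⟨h1, h2⟩, -⟩ := id hd
      exact ⟨h1, by omega, (key d h1 h2).mp hd⟩
    · rintro ⟨h1, h2, h3⟩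
      exact (key d h1 (by omega)).mpr h3

lemma card132 {S : Set ℕ} :
    Nat.card {p : Equiv.Perm (Fin n) // Avoids132 p ∧ Des p = revCompl n S} =
      Nat.card {g : Fin n → Fin n // Mid n S g} := by
  apply Nat.card_eq_of_bijective (fun p => ⟨R p.1, (des_eq_iff p.2.1).mp p.2.2⟩)
  constructor
  · intro p q h
    apply Subtype.ext
    apply C_inj
    funext i
    have h1 := congrArg Fin.val (congrFun (congrArg Subtype.val h) i.rev)
    simpa [R] using h1
  · rintro ⟨g, hg⟩
    obtain ⟨p, hC⟩ := C_surj (fun i => (g i.rev : ℕ)) (fun i => by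
      have h1 := hg.2.1 i.rev
      rw [Fin.le_def, Fin.val_rev] at h1
      have := i.2
      omega)
    have hp : Avoids132 p := by
      apply avoids_of_anti
      rw [hC]
      exact fun a b hab => hg.1 (Fin.rev_le_rev.mpr hab)
    have hR : R p = g := by
      funext i
      ext
      simp [R, hC]
    exact ⟨⟨p, hp, (des_eq_iff hp).mpr (hR ▸ hg)⟩, Subtype.ext hR⟩

end Stmt9

/-- The number of 321-avoiding permutations of `[n]` with excedence set
exactly `S` equals the number of 132-avoiding permutations of `[n]` with
descent set exactly `α(S)`. -/
theorem stmt9 (n : ℕ) (hn : 1 ≤ n) (S : Set ℕ) (hS : S ⊆ Set.Icc 1 (n - 1)) :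
    Nat.card {p : Equiv.Perm (Fin n) // Avoids321 p ∧ Exc p = S} =
      Nat.card {p : Equiv.Perm (Fin n) // Avoids132 p ∧ Des p = revCompl n S} := by
  rw [Stmt9.card321 hS, Stmt9.card132]
end

section
/- For every n ≥ 1 there exists a bijection φ from the set NC^B_n of type-B noncrossing partitions of [n] onto B_n(21, 2̄1̄) which is order-preserving from the refinement order to the descent-set order: whenever π ≤ τ in NC^B_n, Des(φ(π)) ⊆ Des(φ(τ)). (That is, the poset P^B_n of elements of B_n(21, 2̄1̄) ordered by containment of descent sets is an extension of the type-B noncrossing partition lattice NC^B_n.) -/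
/-- A signed permutation of `[n]`: an underlying (absolute-value) permutation
`perm` of `Fin n` (0-based) together with a bar indicator on each position. -/
structure SignedPerm (n : ℕ) where
  perm : Equiv.Perm (Fin n)
  bar : Fin n → Bool

/-- `b` avoids the patterns `21` and `2̄1̄`: there are no positions `i < j`
with `b_i` and `b_j` both barred or both unbarred and `|b_i| > |b_j|`. -/
def AvoidsB {n : ℕ} (b : SignedPerm n) : Prop :=
  ∀ i j : Fin n, i < j → b.bar i = b.bar j → ¬ b.perm j < b.perm i

/-- The rank of the symbol in position `i` of `b` with respect to the total
order `1 < 2 < ⋯ < n < n̄ < ⋯ < 2̄ < 1̄` (0-based: an unbarred value `v` has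
rank `v`, a barred value `v` has rank `2n - 1 - v`). -/
def symbKey {n : ℕ} (b : SignedPerm n) (i : Fin n) : ℕ :=
  if b.bar i then 2 * n - 1 - (b.perm i : ℕ) else (b.perm i : ℕ)

/-- The descent set of a signed permutation, as a set of 1-based positions in
`[n]`: `i ∈ [n-1]` is a descent iff `b_i > b_{i+1}` in the order
`1 < ⋯ < n < n̄ < ⋯ < 1̄`, and `n` is a descent iff `b_n` is barred. -/
def DesB {n : ℕ} (b : SignedPerm n) : Set ℕ :=
  {i | (∃ h : 1 ≤ i ∧ i < n,
          symbKey b ⟨i, h.2⟩ <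
            symbKey b ⟨i - 1, Nat.lt_of_le_of_lt (Nat.sub_le i 1) h.2⟩)
    ∨ (∃ h : 0 < n, i = n ∧ b.bar ⟨n - 1, Nat.sub_lt h Nat.one_pos⟩ = true)}

/-- The ground set `{1, …, n, -1, …, -n}` of type-B partitions of `[n]` is
encoded as `Fin (2*n)`, listed in the clockwise circular order
`1, 2, …, n, -1, -2, …, -n` (so index `e < n` represents `e+1` and index
`e ≥ n` represents `-(e-n+1)`).  Negation is rotation by `n`. -/
def negB {n : ℕ} (i : Fin (2 * n)) : Fin (2 * n) :=
  ⟨((i : ℕ) + n) % (2 * n), Nat.mod_lt _ i.pos⟩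

/-- A type-B noncrossing partition of `[n]`: a partition (setoid) of the `2n`
elements above which is invariant under negation, has at most one block fixed
by negation (the zero-block), and is noncrossing with respect to the circular
order (equivalently, to the linear order on `Fin (2*n)`). -/
def IsNCB {n : ℕ} (r : Setoid (Fin (2 * n))) : Prop :=
  (∀ i j, r.r i j → r.r (negB i) (negB j)) ∧
  (∀ i j, r.r i (negB i) → r.r j (negB j) → r.r i j) ∧
  ¬ ∃ a b c d : Fin (2 * n),
      a < b ∧ b < c ∧ c < d ∧ r.r a c ∧ r.r b d ∧ ¬ r.r a b


namespace NCB

/-- The lifted relation on the integers. -/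
structure Cyc (n : ℤ) (P : ℤ → ℤ → Prop) : Prop where
  refl : ∀ x, P x x
  symm : ∀ {x y}, P x y → P y x
  trans : ∀ {x y z}, P x y → P y z → P x z
  per2 : ∀ x, P x (x + 2 * n)
  per : ∀ x y, P x y → P (x + n) (y + n)
  nc : ∀ a b c d, a < b → b < c → c < d → d < a + 2 * n → P a c → P b d → P a b

/-- An arc of length `L` joining cyclically consecutive elements of a block. -/
def Arc (n : ℤ) (P : ℤ → ℤ → Prop) (x L : ℤ) : Prop :=
  0 < L ∧ L ≤ n ∧ P x (x + L) ∧ ∀ j, 0 < j → j < L → ¬ P x (x + j)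

def SS (n : ℤ) (P : ℤ → ℤ → Prop) (x : ℤ) : Prop := ∃ j, 0 < j ∧ j ≤ n ∧ P x (x - j)
def TT (n : ℤ) (P : ℤ → ℤ → Prop) (x : ℤ) : Prop := ∃ j, 0 < j ∧ j ≤ n ∧ P x (x + j)

theorem exists_min (p : ℤ → Prop) (j : ℤ) (hj : 0 < j) (hp : p j) :
    ∃ L, 0 < L ∧ L ≤ j ∧ p L ∧ ∀ i, 0 < i → i < L → ¬ p i := by
  classical
  have hex : ∃ m : ℕ, 0 < m ∧ p m := ⟨j.toNat, by omega, by rwa [Int.toNat_of_nonneg hj.le]⟩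
  refine ⟨(Nat.find hex : ℕ), ?_, ?_, (Nat.find_spec hex).2, ?_⟩
  · exact_mod_cast (Nat.find_spec hex).1
  · have := Nat.find_min' hex (m := j.toNat) ⟨by omega, by rwa [Int.toNat_of_nonneg hj.le]⟩
    omega
  · intro i hi hiL hpi
    have := Nat.find_min' hex (m := i.toNat) ⟨by omega, by rwa [Int.toNat_of_nonneg hi.le]⟩
    omega

section
variable {n : ℤ} {P P' : ℤ → ℤ → Prop}

theorem TT.arc (_h : Cyc n P) {x j : ℤ} (h0 : 0 < j) (hjn : j ≤ n) (hp : P x (x + j)) :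
    ∃ L, L ≤ j ∧ Arc n P x L := by
  obtain ⟨L, h1, h2, h3, h4⟩ := exists_min (fun j => P x (x + j)) j h0 hp
  exact ⟨L, h2, h1, by omega, h3, h4⟩

theorem SS.arc (h : Cyc n P) {x : ℤ} (hx : SS n P x) : ∃ L, Arc n P (x - L) L := by
  obtain ⟨j, h0, hjn, hp⟩ := hx
  obtain ⟨L, h1, h2, h3, h4⟩ := exists_min (fun j => P x (x - j)) j h0 hp
  refine ⟨L, h1, by omega, ?_, ?_⟩
  · simpa using h.symm h3
  · intro i hi hiL hp'
    apply h4 (L - i) (by omega) (by omega)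
    have := h.trans h3 hp'
    rwa [show x - L + i = x - (L - i) by ring] at this

theorem Arc.ss (h : Cyc n P) {x L : ℤ} (ha : Arc n P x L) : SS n P (x + L) :=
  ⟨L, ha.1, ha.2.1, by simpa using h.symm ha.2.2.1⟩

theorem Arc.tt {x L : ℤ} (ha : Arc n P x L) : TT n P x := ⟨L, ha.1, ha.2.1, ha.2.2.1⟩

theorem arc_aux (h : Cyc n P) (h' : Cyc n P') (hS : ∀ x, SS n P x → SS n P' x)
    (hT : ∀ x, TT n P x → TT n P' x) (L : ℤ)
    (ih : ∀ M, M < L → ∀ x, Arc n P' x M → Arc n P x M) (x : ℤ) (ha : Arc n P x L) :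
    Arc n P' x L := by
  obtain ⟨j, h0, hj, hp⟩ := hT x ha.tt
  obtain ⟨L', -, ha'⟩ := TT.arc h' h0 hj hp
  rcases lt_trichotomy L' L with hl | rfl | hl
  · exact absurd (ih L' hl x ha').2.2.1 (ha.2.2.2 _ ha'.1 hl)
  · exact ha'
  · obtain ⟨M, hM⟩ := SS.arc h' (hS _ (ha.ss h))
    rcases lt_trichotomy M L with hm | rfl | hm
    · have h1 := ih M hm _ hM
      have h2 : P (x + L - M) (x + L) := by simpa using h1.2.2.1
      have h3 := h.trans ha.2.2.1 (h.symm h2)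
      rw [show x + L - M = x + (L - M) by ring] at h3
      exact absurd h3 (ha.2.2.2 _ (by omega) (by have := h1.1; omega))
    · simpa using hM
    · exfalso
      have e1 := hM.1
      have e2 := hM.2.1
      have e3 := ha.1
      have e4 := ha'.2.1
      have h2 : P' (x + L - M) (x + L) := by simpa using hM.2.2.1
      have := h'.nc (x + L - M) x (x + L) (x + L') (by omega) (by omega) (by omega) (by omega)
        h2 ha'.2.2.1
      apply hM.2.2.2 (M - L) (by omega) (by omega)
      rwa [show x + L - M + (M - L) = x by ring]

theorem arc_iff (h : Cyc n P) (h' : Cyc n P') (hS : ∀ x, SS n P x ↔ SS n P' x)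
    (hT : ∀ x, TT n P x ↔ TT n P' x) (m : ℕ) :
    ∀ L : ℤ, L < m → ∀ x, Arc n P x L ↔ Arc n P' x L := by
  induction m with
  | zero => intro L hL x; constructor <;> (intro ha; have := ha.1; omega)
  | succ m ih =>
    intro L hL x
    constructor
    · exact arc_aux h h' (fun x => (hS x).1) (fun x => (hT x).1) L
        (fun M hM x => (ih M (by push_cast at hL; omega) x).2) x
    · exact arc_aux h' h (fun x => (hS x).2) (fun x => (hT x).2) L
        (fun M hM x => (ih M (by push_cast at hL; omega) x).1) x

theorem rel_short (h : Cyc n P) (h' : Cyc n P') (ha : ∀ x L, Arc n P x L → Arc n P' x L)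
    (m : ℕ) : ∀ D : ℤ, 0 ≤ D → D < m → D ≤ n → ∀ x, P x (x + D) → P' x (x + D) := by
  induction m with
  | zero => intro D h0 h1; omega
  | succ m ih =>
    intro D h0 h1 h2 x hx
    rcases h0.eq_or_lt with rfl | h0
    · simpa using h'.refl x
    · obtain ⟨L, hL, hA⟩ := TT.arc h h0 h2 hx
      have e := hA.1
      refine h'.trans (ha _ _ hA).2.2.1 ?_
      have := ih (D - L) (by omega) (by push_cast at h1; omega) (by omega) (x + L)
      simp only [add_add_sub_cancel] at this
      exact this (h.trans (h.symm hA.2.2.1) hx)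

theorem Cyc.per2k (h : Cyc n P) (x : ℤ) (k : ℤ) : P x (x + 2 * n * k) := by
  induction k using Int.induction_on with
  | zero => simpa using h.refl x
  | succ i ih =>
    have := h.trans ih (h.per2 _)
    rwa [show x + 2 * n * (i + 1 : ℤ) = x + 2 * n * i + 2 * n by ring]
  | pred i ih =>
    refine h.trans ih (h.symm ?_)
    have := h.per2 (x + 2 * n * (-i - 1 : ℤ))
    rwa [show x + 2 * n * (-i - 1 : ℤ) + 2 * n = x + 2 * n * (-i : ℤ) by ring] at this

theorem Cyc.pern (h : Cyc n P) {x y : ℤ} (hxy : P x y) (k : ℤ) : P (x + n * k) (y + n * k) := by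
  induction k using Int.induction_on with
  | zero => simpa using hxy
  | succ i ih =>
    have := h.per _ _ ih
    rwa [show x + n * (i + 1 : ℤ) = x + n * i + n by ring,
      show y + n * (i + 1 : ℤ) = y + n * i + n by ring]
  | pred i ih =>
    have := h.per _ _ ih
    have e : ∀ x : ℤ, P (x + n * (-i : ℤ) + n) (x + n * (-i - 1 : ℤ)) := by
      intro x
      have := h.per2 (x + n * (-i - 1 : ℤ))
      rw [show x + n * (-i : ℤ) + n = x + n * (-i - 1 : ℤ) + 2 * n by ring]
      exact h.symm this
    exact h.trans (h.symm (e x)) (h.trans this (e y))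

theorem rel_le (hn : 0 < n) (h : Cyc n P) (h' : Cyc n P') (hS : ∀ x, SS n P x ↔ SS n P' x)
    (hT : ∀ x, TT n P x ↔ TT n P' x) (x y : ℤ) (hxy : P x y) : P' x y := by
  have ha : ∀ x L, Arc n P x L → Arc n P' x L := fun x L =>
    (arc_iff h h' hS hT (L.toNat + 1) L (by omega) x).1
  have hs : ∀ D : ℤ, 0 ≤ D → D ≤ n → ∀ x, P x (x + D) → P' x (x + D) := fun D h0 h1 =>
    rel_short h h' ha (D.toNat + 1) D h0 (by omega) h1
  -- normalise `y`
  set q := (y - x) / (2 * n)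
  set D := (y - x) % (2 * n) with hD
  have e : x + D + 2 * n * q = y := by
    have h3 : D + 2 * n * q = y - x := Int.emod_add_mul_ediv (y - x) (2 * n)
    linarith
  have h0 : 0 ≤ D := Int.emod_nonneg _ (by omega)
  have h1 : D < 2 * n := Int.emod_lt_of_pos _ (by omega)
  have h2 : P x (x + D) := by
    rw [← e] at hxy
    exact h.trans hxy (h.symm (h.per2k _ _))
  suffices P' x (x + D) by
    rw [← e]; exact h'.trans this (h'.per2k _ _)
  by_cases hDn : D ≤ n
  · exact hs D h0 hDn x h2
  · have := hs (2 * n - D) (by omega) (by omega) (x + D)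
    rw [show x + D + (2 * n - D) = x + 2 * n by ring] at this
    exact h'.trans (h'.per2 x) (h'.symm (this (h.trans (h.symm h2) (h.per2 x))))

theorem SS_per (h : Cyc n P) (x k : ℤ) : SS n P x → SS n P (x + n * k) := by
  rintro ⟨j, h0, h1, h2⟩
  refine ⟨j, h0, h1, ?_⟩
  have := h.pern h2 k
  rwa [show x - j + n * k = x + n * k - j by ring] at this

theorem TT_per (h : Cyc n P) (x k : ℤ) : TT n P x → TT n P (x + n * k) := by
  rintro ⟨j, h0, h1, h2⟩
  refine ⟨j, h0, h1, ?_⟩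
  have := h.pern h2 k
  rwa [show x + j + n * k = x + n * k + j by ring] at this

theorem Arc_per (h : Cyc n P) (x k L : ℤ) (ha : Arc n P x L) : Arc n P (x + n * k) L := by
  refine ⟨ha.1, ha.2.1, ?_, ?_⟩
  · have := h.pern ha.2.2.1 k
    rwa [show x + L + n * k = x + n * k + L by ring] at this
  · intro j h0 h1 h2
    apply ha.2.2.2 j h0 h1
    have := h.pern h2 (-k)
    rwa [show x + n * k + n * -k = x by ring, show x + n * k + j + n * -k = x + j by ring] at this

theorem Arc_uniq {x L M : ℤ} (ha : Arc n P x L) (hb : Arc n P x M) : L = M := by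
  rcases lt_trichotomy L M with hl | rfl | hl
  · exact absurd ha.2.2.1 (hb.2.2.2 _ ha.1 hl)
  · rfl
  · exact absurd hb.2.2.1 (ha.2.2.2 _ hb.1 hl)

theorem Arc_uniq' (h : Cyc n P) {x y L M : ℤ} (ha : Arc n P x L) (hb : Arc n P y M)
    (e : x + L = y + M) : x = y := by
  have key : ∀ {x y L M : ℤ}, Arc n P x L → Arc n P y M → x + L = y + M → x < y → False := by
    intro x y L M ha hb e hxy
    have h1 := h.trans ha.2.2.1 (h.symm (e ▸ hb.2.2.1))
    apply ha.2.2.2 (y - x) (by omega) (by have := hb.1; omega)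
    rwa [add_sub_cancel]
  rcases lt_trichotomy x y with hl | hl | hl
  · exact (key ha hb e hl).elim
  · exact hl
  · exact (key hb ha e.symm hl).elim

end

theorem card_eq (n : ℕ) (hn : 0 < n) {P : ℤ → ℤ → Prop} (h : Cyc n P) (A B : Finset (Fin n))
    (hA : ∀ i : Fin n, i ∈ A ↔ SS n P (i : ℕ)) (hB : ∀ i : Fin n, i ∈ B ↔ TT n P (i : ℕ)) :
    A.card = B.card := by
  classical
  let cl : ℤ → Fin n := fun x => ⟨(x % n).toNat, by
    have := Int.emod_lt_of_pos x (b := n) (by omega)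
    have := Int.emod_nonneg x (b := n) (by omega)
    omega⟩
  have clspec : ∀ x : ℤ, ∃ k : ℤ, ((cl x : ℕ) : ℤ) = x + n * k := fun x => by
    refine ⟨-(x / n), ?_⟩
    have h1 := Int.emod_nonneg x (b := n) (by omega)
    have h2 := Int.emod_add_mul_ediv x n
    simp only [cl, Int.toNat_of_nonneg h1]
    linarith [neg_mul_eq_mul_neg (n : ℤ) (x / n)]
  have fineq : ∀ (i j : Fin n) (k : ℤ), (i : ℤ) = j + n * k → i = j := by
    intro i j k hk
    have h1 := congrArg (· % (n : ℤ)) hk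
    simp only [Int.add_mul_emod_self_left] at h1
    rw [Int.emod_eq_of_lt (by omega) (by omega), Int.emod_eq_of_lt (by omega) (by omega)] at h1
    ext; omega
  have hex : ∀ i ∈ B, ∃ L, Arc n P (i : ℕ) L := by
    intro i hi
    obtain ⟨j, h0, h1, h2⟩ := (hB i).1 hi
    obtain ⟨L, -, hL⟩ := TT.arc h h0 h1 h2
    exact ⟨L, hL⟩
  choose! f hf using hex
  symm
  apply Finset.card_bij (fun i _ => cl (i + f i))
  · intro i hi
    rw [hA]
    obtain ⟨k, hk⟩ := clspec (i + f i)
    rw [hk]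
    exact SS_per h _ _ ((hf i hi).ss h)
  · intro i hi j hj hij
    obtain ⟨k, hk⟩ := clspec (i + f i)
    obtain ⟨l, hl⟩ := clspec (j + f j)
    rw [hij] at hk
    apply fineq i j (l - k)
    refine Arc_uniq' h (hf i hi) (Arc_per h _ (l - k) _ (hf j hj)) ?_
    linarith
  · intro i hi
    obtain ⟨L, hL⟩ := SS.arc h ((hA i).1 hi)
    obtain ⟨k, hk⟩ := clspec (i - L)
    have h1 := Arc_per h _ k _ hL
    rw [← hk] at h1
    have h2 : cl (i - L) ∈ B := (hB _).2 h1.tt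
    refine ⟨_, h2, ?_⟩
    have h3 := Arc_uniq h1 (hf _ h2)
    rw [← h3]
    obtain ⟨l, hl⟩ := clspec (cl (i - L) + L)
    apply fineq _ _ (k + l)
    rw [hl, hk]; ring

end NCB

namespace NCB

/-- Height data. -/
structure Hts (n : ℤ) (H g : ℤ → ℤ) : Prop where
  pos : 0 < n
  a1 : ∀ z, g z ≤ H z
  a2 : ∀ z, H z ≤ g z + 1
  b1 : ∀ z, g z ≤ H (z + 1)
  b2 : ∀ z, H (z + 1) ≤ g z + 1
  perH : ∀ z, H (z + n) = H z
  perg : ∀ z, g (z + n) = g z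

def RR (H g : ℤ → ℤ) (x y : ℤ) : Prop :=
  g x = g y ∧ ∀ z, (x < z ∧ z ≤ y ∨ y < z ∧ z ≤ x) → g x < H z

def QQ (n : ℤ) (H g : ℤ → ℤ) (x y : ℤ) : Prop := ∃ k : ℤ, RR H g x (y + 2 * n * k)

section
variable {n : ℤ} {H g : ℤ → ℤ}

theorem perk (f : ℤ → ℤ) (hf : ∀ z, f (z + n) = f z) (k z : ℤ) : f (z + n * k) = f z := by
  induction k using Int.induction_on with
  | zero => simp
  | succ i ih => rw [← ih, ← hf (z + n * i)]; congr 1; ring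
  | pred i ih => rw [← ih, ← hf (z + n * (-i - 1 : ℤ))]; congr 1; ring

theorem RR.refl (x : ℤ) : RR H g x x := ⟨rfl, fun z hz => by omega⟩

theorem RR.symm {x y : ℤ} (h : RR H g x y) : RR H g y x :=
  ⟨h.1.symm, fun z hz => by rw [← h.1]; exact h.2 z (by omega)⟩

theorem RR.trans {x y z : ℤ} (h : RR H g x y) (h' : RR H g y z) : RR H g x z := by
  refine ⟨h.1.trans h'.1, fun w hw => ?_⟩
  by_cases h1 : (x < w ∧ w ≤ y ∨ y < w ∧ w ≤ x)
  · exact h.2 w h1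
  · rw [h.1]; exact h'.2 w (by omega)

theorem RR.shift (hh : Hts n H g) {x y : ℤ} (h : RR H g x y) (k : ℤ) :
    RR H g (x + n * k) (y + n * k) := by
  refine ⟨by rw [perk g hh.perg, perk g hh.perg, h.1], fun z hz => ?_⟩
  rw [perk g hh.perg]
  have := h.2 (z + n * (-k)) (by rw [mul_neg]; omega)
  rwa [perk H hh.perH] at this

theorem RR.nc (hh : Hts n H g) {a b c d : ℤ} (hab : a < b) (hbc : b < c) (hcd : c < d)
    (h1 : RR H g a c) (h2 : RR H g b d) : RR H g a b := by
  have e1 := h1.2 b (by omega)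
  have e2 := h2.2 c (by omega)
  have e3 := hh.a2 b
  have e4 := hh.a2 c
  have e5 := h1.1
  exact ⟨by omega, fun z hz => h1.2 z (by omega)⟩

theorem RR.far (hh : Hts n H g) {x y : ℤ} (h : RR H g x y) (hf : x + n ≤ y ∨ y + n ≤ x) :
    ∀ z, g x < H z := by
  have key : ∀ {x y : ℤ}, RR H g x y → x + n ≤ y → ∀ z, g x < H z := by
    intro x y h hf z
    have hp := hh.pos
    have h0 := Int.emod_nonneg (z - (x + 1)) (b := n) (by omega)
    have h1 := Int.emod_lt_of_pos (z - (x + 1)) (b := n) (by omega)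
    have h2 := Int.emod_add_mul_ediv (z - (x + 1)) n
    have := h.2 (x + 1 + (z - (x + 1)) % n) (by omega)
    rw [← perk H hh.perH ((z - (x + 1)) / n)] at this
    rwa [show x + 1 + (z - (x + 1)) % n + n * ((z - (x + 1)) / n) = z by linarith] at this
  rcases hf with hf | hf
  · exact key h hf
  · rw [h.1]; exact key h.symm hf

theorem RR.zero (hh : Hts n H g) {x y : ℤ} (hx : ∀ z, g x < H z) (hy : ∀ z, g y < H z) :
    RR H g x y := by
  have := hx y; have := hy x; have := hh.a2 x; have := hh.a2 y
  exact ⟨by omega, fun z _ => hx z⟩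

theorem RR.q {x y : ℤ} (h : RR H g x y) : QQ n H g x y := ⟨0, by simpa using h⟩

theorem QQ.symm (hh : Hts n H g) {x y : ℤ} (h : QQ n H g x y) : QQ n H g y x := by
  obtain ⟨k, hk⟩ := h
  refine ⟨-k, ?_⟩
  have := hk.symm.shift hh (2 * (-k))
  rwa [show y + 2 * n * k + n * (2 * (-k)) = y by ring,
    show x + n * (2 * (-k)) = x + 2 * n * (-k) by ring] at this

theorem QQ.trans (hh : Hts n H g) {x y z : ℤ} (h : QQ n H g x y) (h' : QQ n H g y z) :
    QQ n H g x z := by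
  obtain ⟨k, hk⟩ := h
  obtain ⟨l, hl⟩ := h'
  refine ⟨k + l, hk.trans ?_⟩
  have := hl.shift hh (2 * k)
  rwa [show y + n * (2 * k) = y + 2 * n * k by ring,
    show z + 2 * n * l + n * (2 * k) = z + 2 * n * (k + l) by ring] at this

theorem QQ.per2 (x k : ℤ) : QQ n H g x (x + 2 * n * k) :=
  ⟨-k, by rw [show x + 2 * n * k + 2 * n * (-k) = x by ring]; exact RR.refl x⟩

theorem QQ.shift (hh : Hts n H g) {x y : ℤ} (h : QQ n H g x y) (l : ℤ) :
    QQ n H g (x + n * l) (y + n * l) := by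
  obtain ⟨k, hk⟩ := h
  refine ⟨k, ?_⟩
  have := hk.shift hh l
  rwa [show y + 2 * n * k + n * l = y + n * l + 2 * n * k by ring] at this

theorem QQ.cases (hh : Hts n H g) {x y : ℤ} (h : QQ n H g x y) (hxy : x ≤ y) (hyx : y < x + 2 * n) :
    RR H g x y ∨ RR H g y (x + 2 * n) := by
  obtain ⟨k, hk⟩ := h
  by_cases h0 : k = 0
  · subst h0; left; simpa using hk
  by_cases h1 : k = -1
  · subst h1; right
    have := (hk.shift hh 2).symm
    rwa [show y + 2 * n * -1 + n * 2 = y by ring, mul_comm n 2] at this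
  left
  have hp := hh.pos
  have hf : x + n ≤ y + 2 * n * k ∨ y + 2 * n * k + n ≤ x := by
    rcases lt_or_ge k 0 with hk0 | hk0
    · right; have : k ≤ -2 := by omega
      nlinarith
    · left; have : 1 ≤ k := by omega
      nlinarith
  have hx := hk.far hh hf
  have e : g (y + 2 * n * k) = g y := by
    rw [show y + 2 * n * k = y + n * (2 * k) by ring, perk g hh.perg]
  exact RR.zero hh hx (by rw [← e, ← hk.1]; exact hx)

theorem QQ.nc (hh : Hts n H g) {a b c d : ℤ} (hab : a < b) (hbc : b < c) (hcd : c < d)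
    (hda : d < a + 2 * n) (h1 : QQ n H g a c) (h2 : QQ n H g b d) : QQ n H g a b := by
  have e : ∀ x, QQ n H g x (x + 2 * n) := fun x => by simpa using QQ.per2 (n := n) (H := H) (g := g) x 1
  have sh : ∀ x y, RR H g x y → RR H g (x + 2 * n) (y + 2 * n) := fun x y h => by
    have := h.shift hh 2
    rwa [mul_comm n 2] at this
  rcases h1.cases hh (by omega) (by omega) with h1' | h1' <;>
  rcases h2.cases hh (by omega) (by omega) with h2' | h2'
  · exact (RR.nc hh hab hbc hcd h1' h2').q
  · have := RR.nc hh (a := d) (b := a + 2 * n) (c := b + 2 * n) (d := c + 2 * n) (by omega)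
      (by omega) (by omega) h2' (sh _ _ h1')
    exact (e a).trans hh (this.q.symm hh |>.trans hh (h2.symm hh))
  · have := RR.nc hh (a := b) (b := c) (c := d) (d := a + 2 * n) (by omega)
      (by omega) (by omega) h2' h1'
    exact h1.trans hh (this.q.symm hh)
  · have := RR.nc hh (a := c) (b := d) (c := a + 2 * n) (d := b + 2 * n) (by omega)
      (by omega) (by omega) h1' h2'
    exact h1.trans hh (this.q.trans hh (h2.symm hh))

theorem QQ.cyc (hh : Hts n H g) : Cyc n (QQ n H g) where
  refl x := (RR.refl x).q
  symm h := h.symm hh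
  trans h h' := h.trans hh h'
  per2 x := by simpa using QQ.per2 (n := n) (H := H) (g := g) x 1
  per x y h := by simpa using h.shift hh 1
  nc a b c d h1 h2 h3 h4 h5 h6 := QQ.nc hh h1 h2 h3 h4 h5 h6

theorem QQ.zz (hh : Hts n H g) {x y : ℤ} (hx : QQ n H g x (x + n)) (hy : QQ n H g y (y + n)) :
    QQ n H g x y := by
  have key : ∀ x, QQ n H g x (x + n) → ∀ z, g x < H z := by
    intro x hx
    have hp := hh.pos
    rcases hx.cases hh (by omega) (by omega) with h | h
    · exact h.far hh (by omega)
    · have := h.far hh (by omega)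
      rwa [hh.perg] at this
  exact (RR.zero hh (key x hx) (key y hy)).q

theorem QQ.ss (hh : Hts n H g) (x : ℤ) : SS n (QQ n H g) x ↔ g x < H x := by
  have hp := hh.pos
  constructor
  · rintro ⟨j, h0, h1, h2⟩
    rcases (h2.symm hh).cases hh (by omega) (by omega) with h | h
    · have := h.2 x (by omega)
      rwa [h.1] at this
    · exact h.far hh (by omega) x
  · intro hx
    obtain ⟨j, h0, h1, h2, h3⟩ := exists_min (fun j => g (x - j) ≤ g x) n hp (by
      have := hh.perg (x - n); simp at this; simp [this])
    have ab : ∀ z, x - j < z → z ≤ x → g x < H z := by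
      intro z hz hzx
      rcases hzx.eq_or_lt with rfl | hzx
      · exact hx
      · have := h3 (x - z) (by omega) (by omega)
        rw [sub_sub_cancel] at this
        have := hh.a1 z
        omega
    refine ⟨j, h0, h1, RR.q ⟨?_, ?_⟩⟩
    · have := ab (x - j + 1) (by omega) (by omega)
      have := hh.b2 (x - j)
      omega
    · intro z hz
      exact ab z (by omega) (by omega)

theorem QQ.tt (hh : Hts n H g) (x : ℤ) : TT n (QQ n H g) x ↔ g x < H (x + 1) := by
  have hp := hh.pos
  constructor
  · rintro ⟨j, h0, h1, h2⟩
    rcases h2.cases hh (by omega) (by omega) with h | h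
    · exact h.2 (x + 1) (by omega)
    · have := h.symm.far hh (by omega) (x + 1)
      rwa [show x + 2 * n = x + n + n by ring, hh.perg, hh.perg] at this
  · intro hx
    obtain ⟨j, h0, h1, h2, h3⟩ := exists_min (fun j => g (x + j) ≤ g x) n hp (by
      simp [hh.perg])
    have ab : ∀ z, x < z → z ≤ x + j → g x < H z := by
      intro z hz hzx
      by_cases hz1 : z = x + 1
      · rw [hz1]; exact hx
      · have := h3 (z - 1 - x) (by omega) (by omega)
        rw [add_sub_cancel] at this
        have := hh.b1 (z - 1)
        rw [sub_add_cancel] at this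
        omega
    refine ⟨j, h0, h1, RR.q ⟨?_, ?_⟩⟩
    · have := ab (x + j) (by omega) (by omega)
      have := hh.a2 (x + j)
      omega
    · intro z hz
      exact ab z (by omega) (by omega)

end

open Classical in
/-- Existence of heights from two sets of equal size. -/
theorem exists_hts (n : ℕ) (hn : 0 < n) (A B : Finset (Fin n)) (hAB : A.card = B.card) :
    ∃ H g : ℤ → ℤ, Hts n H g ∧ (∀ i : Fin n, g (i : ℕ) < H (i : ℕ) ↔ i ∈ A) ∧
      (∀ i : Fin n, g (i : ℕ) < H ((i : ℕ) + 1) ↔ i ∈ B) := by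
  have hcl : ∀ x : ℤ, (x % n).toNat < n := fun x => by
    have := Int.emod_lt_of_pos x (b := n) (by omega)
    have := Int.emod_nonneg x (b := n) (by omega)
    omega
  let a : ℕ → ℤ := fun m => if h : m < n then (if (⟨m, h⟩ : Fin n) ∈ A then 1 else 0) else 0
  let b : ℕ → ℤ := fun m => if h : m < n then (if (⟨m, h⟩ : Fin n) ∈ B then 1 else 0) else 0
  have ha : ∀ m, 0 ≤ a m ∧ a m ≤ 1 := fun m => by dsimp only [a]; split_ifs <;> simp
  have hb : ∀ m, 0 ≤ b m ∧ b m ≤ 1 := fun m => by dsimp only [b]; split_ifs <;> simp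
  let F : ℕ → ℤ := fun m => ∑ i ∈ Finset.range m, (b i - a i)
  have hsum : F n = 0 := by
    have h1 : ∑ i ∈ Finset.range n, a i = A.card := by
      rw [Finset.sum_range]; simp [a]
    have h2 : ∑ i ∈ Finset.range n, b i = B.card := by
      rw [Finset.sum_range]; simp [b]
    simp only [F, Finset.sum_sub_distrib, h1, h2, hAB, sub_self]
  let r : ℤ → ℕ := fun x => (x % n).toNat
  have hr : ∀ x, r (x + n) = r x := fun x => by simp [r]
  let H : ℤ → ℤ := fun x => F (r x)
  let g : ℤ → ℤ := fun x => H x - a (r x)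
  have hstep : ∀ x, H (x + 1) = H x + b (r x) - a (r x) := by
    intro x
    have h0 := Int.emod_nonneg x (b := n) (by omega)
    have h1 := Int.emod_lt_of_pos x (b := n) (by omega)
    have h2 : F (r x + 1) = F (r x) + (b (r x) - a (r x)) := Finset.sum_range_succ _ _
    have h3 : H (x + 1) = F (r x + 1) := by
      have e : (x + 1) % n = (x % n + 1) % n := by simp
      by_cases hlt : x % n + 1 < n
      · have : r (x + 1) = r x + 1 := by
          simp only [r, e]
          rw [Int.emod_eq_of_lt (by omega) hlt]; omega
        simp only [H, this]
      · have h4 : x % n + 1 = n := by omega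
        have h5 : r (x + 1) = 0 := by simp only [r, e, h4]; simp
        have h6 : r x + 1 = n := by simp only [r]; omega
        simp only [H, h5, h6, hsum]; simp [F]
    simp only [H] at *
    omega
  have hri : ∀ i : Fin n, r (i : ℕ) = i := fun i => by
    simp only [r]
    rw [Int.emod_eq_of_lt (by omega) (by omega)]; simp
  refine ⟨H, g, ⟨by omega, ?_, ?_, ?_, ?_, ?_, ?_⟩, ?_, ?_⟩
  · intro z; have := ha (r z); simp only [g]; omega
  · intro z; have := ha (r z); simp only [g]; omega
  · intro z; have := hb (r z); rw [hstep]; simp only [g]; omega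
  · intro z; have := hb (r z); rw [hstep]; simp only [g]; omega
  · intro z; simp only [H, hr]
  · intro z; simp only [g, H, hr]
  · intro i
    simp only [g, hri]
    simp [a]; split_ifs <;> simp_all
  · intro i
    rw [hstep]
    simp only [g, hri]
    simp [b]; split_ifs <;> simp_all

end NCB

namespace NCB

def cl (n : ℕ) (hn : 0 < n) (x : ℤ) : Fin (2 * n) := ⟨(x % (2 * n : ℕ)).toNat, by
    have := Int.emod_lt_of_pos x (b := (2 * n : ℕ)) (by omega)
    have := Int.emod_nonneg x (b := (2 * n : ℕ)) (by omega)
    omega⟩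

section
variable {n : ℕ} (hn : 0 < n)

theorem cl_val (x : ℤ) : ((cl n hn x : ℕ) : ℤ) = x % (2 * n : ℕ) :=
  Int.toNat_of_nonneg (Int.emod_nonneg x (b := (2 * n : ℕ)) (by omega))

theorem cl_fin (i : Fin (2 * n)) : cl n hn (i : ℕ) = i := by
  ext
  have := cl_val hn (i : ℕ)
  rw [Int.emod_eq_of_lt (by omega) (by omega)] at this
  exact_mod_cast this

theorem cl_per2k (x k : ℤ) : cl n hn (x + 2 * n * k) = cl n hn x := by
  have h1 := cl_val hn (x + 2 * n * k)
  have h2 := cl_val hn x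
  rw [show (2 * n : ℤ) * k = (2 * n : ℕ) * k by push_cast; ring, Int.add_mul_emod_self_left, ← h2] at h1
  ext; exact_mod_cast h1

theorem cl_per2 (x : ℤ) : cl n hn (x + 2 * n) = cl n hn x := by
  simpa using cl_per2k hn x 1

theorem cl_neg (x : ℤ) : cl n hn (x + n) = negB (cl n hn x) := by
  have h1 := cl_val hn (x + n)
  have h2 := cl_val hn x
  ext
  zify
  rw [h1]
  simp only [negB]
  push_cast
  rw [h2]
  push_cast
  simp

def lift (r : Setoid (Fin (2 * n))) (x y : ℤ) : Prop := r.r (cl n hn x) (cl n hn y)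

theorem lift_cyc {r : Setoid (Fin (2 * n))} (h : IsNCB r) : Cyc n (lift hn r) where
  refl x := r.refl _
  symm h := r.symm h
  trans h h' := r.trans h h'
  per2 x := by unfold lift; rw [cl_per2]
  per x y h' := by unfold lift; rw [cl_neg, cl_neg]; exact h.1 _ _ h'
  nc := by
    have sy : ∀ {x y}, lift hn r x y → lift hn r y x := fun h => r.symm h
    have tr : ∀ {x y z}, lift hn r x y → lift hn r y z → lift hn r x z := fun h h' => r.trans h h'
    have lin : ∀ a b c d : ℤ, 0 ≤ a → a < b → b < c → c < d → d < 2 * n → lift hn r a c →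
        lift hn r b d → lift hn r a b := by
      intro a b c d h0 h1 h2 h3 h4 h5 h6
      by_contra h7
      apply h.2.2
      have vv : ∀ x : ℤ, 0 ≤ x → x < 2 * n → ((cl n hn x : ℕ) : ℤ) = x := fun x hx hx' => by
        rw [cl_val, Int.emod_eq_of_lt hx (by push_cast; exact hx')]
      have va := vv a (by omega) (by omega)
      have vb := vv b (by omega) (by omega)
      have vc := vv c (by omega) (by omega)
      have vd := vv d (by omega) (by omega)
      refine ⟨_, _, _, _, ?_, ?_, ?_, h5, h6, h7⟩ <;> (rw [Fin.lt_def]; omega)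
    have sh : ∀ x k : ℤ, lift hn r x (x - 2 * n * k) := fun x k => by
      unfold lift
      have := cl_per2k hn (x - 2 * n * k) k
      rw [sub_add_cancel] at this
      rw [this]
    have sh1 : ∀ x : ℤ, lift hn r x (x - 2 * n) := fun x => by simpa using sh x 1
    have mid : ∀ a b c d : ℤ, 0 ≤ a → a < 2 * n → a < b → b < c → c < d → d < a + 2 * n →
        lift hn r a c → lift hn r b d → lift hn r a b := by
      intro a b c d h0 h00 h1 h2 h3 h4 h5 h6
      by_cases hd : d < 2 * n
      · exact lin a b c d h0 h1 h2 h3 hd h5 h6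
      by_cases hc : c < 2 * n
      · have := lin (d - 2 * n) a b c (by omega) (by omega) h1 h2 hc (tr (sy (sh1 d)) (sy h6)) h5
        exact tr (sy this) (tr (sy (sh1 d)) (sy h6))
      by_cases hb : b < 2 * n
      · have := lin (c - 2 * n) (d - 2 * n) a b (by omega) (by omega) (by omega) (by omega) hb
          (tr (sy (sh1 c)) (sy h5)) (tr (sy (sh1 d)) (sy h6))
        exact tr h5 (tr (sh1 c) (tr this (tr (sy (sh1 d)) (sy h6))))
      · have := lin (b - 2 * n) (c - 2 * n) (d - 2 * n) a (by omega) (by omega) (by omega)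
          (by omega) (by omega) (tr (sy (sh1 b)) (tr h6 (sh1 d))) (tr (sy (sh1 c)) (sy h5))
        exact tr h5 (tr (sh1 c) (tr (sy this) (sy (sh1 b))))
    intro a b c d h1 h2 h3 h4 h5 h6
    have e0 := Int.emod_nonneg a (b := 2 * n) (by omega)
    have e1 := Int.emod_lt_of_pos a (b := 2 * n) (by omega)
    have e2 := Int.emod_add_mul_ediv a (2 * n)
    generalize hk : 2 * (n : ℤ) * (a / (2 * n)) = K at e2
    have sK : ∀ x : ℤ, lift hn r x (x - K) := fun x => hk ▸ sh x _
    have := mid (a - K) (b - K) (c - K) (d - K) (by omega) (by omega) (by omega) (by omega)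
      (by omega) (by omega) (tr (sy (sK a)) (tr h5 (sK c))) (tr (sy (sK b)) (tr h6 (sK d)))
    exact tr (sK a) (tr this (sy (sK b)))

open Classical in
noncomputable def SF (r : Setoid (Fin (2 * n))) : Finset (Fin n) :=
  Finset.univ.filter fun i => SS n (lift hn r) (i : ℕ)

open Classical in
noncomputable def TF (r : Setoid (Fin (2 * n))) : Finset (Fin n) :=
  Finset.univ.filter fun i => TT n (lift hn r) (i : ℕ)

theorem mem_SF (r : Setoid (Fin (2 * n))) (i : Fin n) :
    i ∈ SF hn r ↔ SS n (lift hn r) (i : ℕ) := by simp [SF]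

theorem mem_TF (r : Setoid (Fin (2 * n))) (i : Fin n) :
    i ∈ TF hn r ↔ TT n (lift hn r) (i : ℕ) := by simp [TF]

theorem SF_mono {r r' : Setoid (Fin (2 * n))} (h : r ≤ r') : SF hn r ⊆ SF hn r' := by
  intro i hi
  rw [mem_SF] at *
  obtain ⟨j, h0, h1, h2⟩ := hi
  exact ⟨j, h0, h1, h h2⟩

abbrev Pairs (n : ℕ) := {p : Finset (Fin n) × Finset (Fin n) // p.1.card = p.2.card}

noncomputable def Psi (r : {r : Setoid (Fin (2 * n)) // IsNCB r}) : Pairs n :=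
  ⟨(SF hn r.1, TF hn r.1), card_eq n hn (lift_cyc hn r.2) _ _ (mem_SF hn _) (mem_TF hn _)⟩

theorem ext_fin (hn : 0 < n) {p q : ℤ → Prop} (hp : ∀ x k : ℤ, p x → p (x + n * k))
    (hq : ∀ x k : ℤ, q x → q (x + n * k)) (h : ∀ i : Fin n, p (i : ℕ) ↔ q (i : ℕ)) (x : ℤ) :
    p x ↔ q x := by
  have e0 := Int.emod_nonneg x (b := n) (by omega)
  have e1 := Int.emod_lt_of_pos x (b := n) (by omega)
  have e2 := Int.emod_add_mul_ediv x n
  have h1 := h ⟨(x % n).toNat, by omega⟩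
  simp only [Int.toNat_of_nonneg e0] at h1
  have e3 : x + n * (-(x / n)) = x % n := by rw [mul_neg]; omega
  constructor
  · intro hx
    have := hp x (-(x / n)) hx
    rw [e3, h1] at this
    have := hq _ (x / n) this
    rwa [e2] at this
  · intro hx
    have := hq x (-(x / n)) hx
    rw [e3, ← h1] at this
    have := hp _ (x / n) this
    rwa [e2] at this

theorem Psi_inj : Function.Injective (Psi hn) := by
  rintro ⟨r, hr⟩ ⟨r', hr'⟩ h
  have hS : SF hn r = SF hn r' := congrArg (fun p : Pairs n => p.1.1) h
  have hT : TF hn r = TF hn r' := congrArg (fun p : Pairs n => p.1.2) h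
  have c := lift_cyc hn hr
  have c' := lift_cyc hn hr'
  have hS' := ext_fin hn (SS_per c) (SS_per c') fun i => by rw [← mem_SF, ← mem_SF, hS]
  have hT' := ext_fin hn (TT_per c) (TT_per c') fun i => by rw [← mem_TF, ← mem_TF, hT]
  have l1 := rel_le (by omega) c c' hS' hT'
  have l2 := rel_le (by omega) c' c (fun x => (hS' x).symm) (fun x => (hT' x).symm)
  ext i j
  have a1 := l1 (i : ℕ) (j : ℕ)
  have a2 := l2 (i : ℕ) (j : ℕ)
  simp only [lift, cl_fin] at a1 a2
  exact ⟨a1, a2⟩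

theorem Psi_surj : Function.Surjective (Psi hn) := by
  rintro ⟨⟨A, B⟩, hAB⟩
  obtain ⟨H, g, hh, hA, hB⟩ := exists_hts n hn A B hAB
  have c := QQ.cyc hh
  let r : Setoid (Fin (2 * n)) :=
    { r := fun i j => QQ n H g (i : ℕ) (j : ℕ)
      iseqv := ⟨fun i => c.refl _, fun h => c.symm h, fun h h' => c.trans h h'⟩ }
  have hcl : ∀ x : ℤ, QQ n H g x (cl n hn x : ℕ) := by
    intro x
    have e2 := Int.emod_add_mul_ediv x (2 * n : ℕ)
    rw [cl_val]
    have := c.per2k (x % (2 * n : ℕ)) (x / (2 * n : ℕ))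
    have e3 : x % ((2 * n : ℕ) : ℤ) + 2 * n * (x / ((2 * n : ℕ) : ℤ)) = x := by
      push_cast at *; exact e2
    rw [e3] at this
    exact c.symm this
  have hl : lift hn r = QQ n H g := by
    ext x y
    exact ⟨fun h => c.trans (hcl x) (c.trans h (c.symm (hcl y))),
      fun h => c.trans (c.symm (hcl x)) (c.trans h (hcl y))⟩
  have hneg : ∀ i : Fin (2 * n), QQ n H g (negB i : ℕ) ((i : ℕ) + n : ℤ) := by
    intro i
    have := hcl ((i : ℕ) + n)
    rw [cl_neg, cl_fin] at this
    exact c.symm this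
  have hr : IsNCB r := by
    refine ⟨?_, ?_, ?_⟩
    · intro i j hij
      exact c.trans (hneg i) (c.trans (c.per _ _ hij) (c.symm (hneg j)))
    · intro i j hi hj
      exact QQ.zz hh (c.trans hi (hneg i)) (c.trans hj (hneg j))
    · rintro ⟨i, j, k, l, h1, h2, h3, h4, h5, h6⟩
      apply h6
      rw [Fin.lt_def] at h1 h2 h3
      have := l.2
      exact c.nc (i : ℕ) (j : ℕ) (k : ℕ) (l : ℕ) (by omega) (by omega) (by omega) (by omega) h4 h5
  refine ⟨⟨r, hr⟩, ?_⟩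
  apply Subtype.ext
  apply Prod.ext
  · ext i
    change i ∈ SF hn r ↔ i ∈ A
    rw [mem_SF, hl, QQ.ss hh, hA]
  · ext i
    change i ∈ TF hn r ↔ i ∈ B
    rw [mem_TF, hl, QQ.tt hh, hB]

end

/-! Signed permutations -/

section
variable {n : ℕ}

def barS (b : SignedPerm n) : Finset (Fin n) := Finset.univ.filter fun i => b.bar i = true

theorem mem_barS (b : SignedPerm n) (i : Fin n) : i ∈ barS b ↔ b.bar i = true := by
  simp [barS]

def Theta (b : {b : SignedPerm n // AvoidsB b}) : Pairs n :=
  ⟨(barS b.1, (barS b.1).map b.1.perm.toEmbedding), by simp⟩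

/-- Two order-monotone injections on a finite set with the same image agree. -/
theorem mono_uniq (s : Finset (Fin n)) (f f' : Fin n → Fin n)
    (hf : ∀ i ∈ s, ∀ j ∈ s, i < j → f i < f j) (hf' : ∀ i ∈ s, ∀ j ∈ s, i < j → f' i < f' j)
    (him : s.image f = s.image f') : ∀ i ∈ s, f i = f' i := by
  have m : StrictMono (fun k : Fin s.card => f (s.orderEmbOfFin rfl k)) := fun a b hab =>
    hf _ (Finset.orderEmbOfFin_mem _ _ _) _ (Finset.orderEmbOfFin_mem _ _ _) (by simpa using hab)
  have m' : StrictMono (fun k : Fin s.card => f' (s.orderEmbOfFin rfl k)) := fun a b hab =>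
    hf' _ (Finset.orderEmbOfFin_mem _ _ _) _ (Finset.orderEmbOfFin_mem _ _ _) (by simpa using hab)
  have rg : ∀ f : Fin n → Fin n,
      Set.range (fun k : Fin s.card => f (s.orderEmbOfFin rfl k)) = (s.image f : Finset (Fin n)) := by
    intro f
    rw [Finset.coe_image, ← Finset.range_orderEmbOfFin s rfl, ← Set.range_comp]
    rfl
  have := (StrictMono.range_inj m m').1 (by rw [rg, rg, him])
  intro i hi
  have hi' : i ∈ Set.range (s.orderEmbOfFin rfl) := by
    rw [Finset.range_orderEmbOfFin]; exact hi
  obtain ⟨k, rfl⟩ := hi'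
  exact congrFun this k

theorem avoid_lt {b : SignedPerm n} (hb : AvoidsB b) {i j : Fin n} (hij : i < j)
    (h : b.bar i = b.bar j) : b.perm i < b.perm j :=
  lt_of_le_of_ne (not_lt.1 (hb i j hij h)) fun e => hij.ne (b.perm.injective e)

theorem Theta_inj : Function.Injective (Theta (n := n)) := by
  rintro ⟨b, hb⟩ ⟨b', hb'⟩ h
  have hS : barS b = barS b' := congrArg (fun p : Pairs n => p.1.1) h
  have hT : (barS b).map b.perm.toEmbedding = (barS b').map b'.perm.toEmbedding :=
    congrArg (fun p : Pairs n => p.1.2) h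
  have hbar : b.bar = b'.bar := by
    funext i
    have : i ∈ barS b ↔ i ∈ barS b' := by rw [hS]
    simp only [barS, Finset.mem_filter, Finset.mem_univ, true_and] at this
    exact Bool.eq_iff_iff.2 this
  have hb1 : ∀ i ∈ barS b, b.bar i = true := fun i hi => by simpa [barS] using hi
  have hb0 : ∀ i ∈ (barS b)ᶜ, b.bar i = false := fun i hi => by simpa [barS] using hi
  have hT2 : (barS b).image b.perm = (barS b).image b'.perm := by
    have := hT
    rw [← hS, Finset.map_eq_image, Finset.map_eq_image] at this
    exact this
  have u1 := mono_uniq (barS b) b.perm b'.perm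
    (fun i hi j hj hij => avoid_lt hb hij (by rw [hb1 i hi, hb1 j hj]))
    (fun i hi j hj hij => avoid_lt hb' hij (by rw [← hbar, hb1 i hi, hb1 j hj]))
    hT2
  have u0 := mono_uniq (barS b)ᶜ b.perm b'.perm
    (fun i hi j hj hij => avoid_lt hb hij (by rw [hb0 i hi, hb0 j hj]))
    (fun i hi j hj hij => avoid_lt hb' hij (by rw [← hbar, hb0 i hi, hb0 j hj]))
    (by
      have cc : ∀ p : Equiv.Perm (Fin n), (barS b)ᶜ.image p = ((barS b).image p)ᶜ := fun p => by
        apply Finset.coe_injective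
        push_cast
        exact Set.image_compl_eq p.bijective
      rw [cc, cc, hT2])
  have hperm : b.perm = b'.perm := by
    ext i : 1
    by_cases hi : i ∈ barS b
    · exact u1 i hi
    · exact u0 i (by simpa using hi)
  cases b; cases b'
  simp_all

theorem Theta_surj : Function.Surjective (Theta (n := n)) := by
  classical
  rintro ⟨⟨A, B⟩, hAB⟩
  simp only at hAB
  let e1 : {x // x ∈ A} ≃o {x // x ∈ B} := (A.orderIsoOfFin hAB).symm.trans (B.orderIsoOfFin rfl)
  have hc : (Aᶜ : Finset (Fin n)).card = (Bᶜ : Finset (Fin n)).card := by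
    rw [Finset.card_compl, Finset.card_compl, hAB]
  let e0 : {x // x ∈ Aᶜ} ≃o {x // x ∈ Bᶜ} :=
    (Aᶜ.orderIsoOfFin hc).symm.trans (Bᶜ.orderIsoOfFin rfl)
  let e0' : {x // ¬ x ∈ A} ≃ {x // ¬ x ∈ B} :=
    (Equiv.subtypeEquivRight (fun x => by simp)).trans
      (e0.toEquiv.trans (Equiv.subtypeEquivRight (fun x => by simp)))
  let p : Equiv.Perm (Fin n) := Equiv.subtypeCongr e1.toEquiv e0'
  have p1 : ∀ (i : Fin n) (hi : i ∈ A), p i = e1 ⟨i, hi⟩ := fun i hi => by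
    simp [p, Equiv.subtypeCongr, hi]
  have p0 : ∀ (i : Fin n) (hi : i ∉ A), p i = e0 ⟨i, by simpa using hi⟩ := fun i hi => by
    simp [p, Equiv.subtypeCongr, hi, e0']
    rfl
  let b : SignedPerm n := ⟨p, fun i => decide (i ∈ A)⟩
  have hb : AvoidsB b := by
    intro i j hij hbar
    rw [not_lt]
    change p i ≤ p j
    by_cases hi : i ∈ A
    · have hj : j ∈ A := by simpa [b, hi] using hbar
      rw [p1 i hi, p1 j hj]
      exact Subtype.coe_le_coe.2 (e1.monotone (Subtype.mk_le_mk.2 hij.le))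
    · have hj : j ∉ A := by simpa [b, hi] using hbar
      rw [p0 i hi, p0 j hj]
      exact Subtype.coe_le_coe.2 (e0.monotone (Subtype.mk_le_mk.2 hij.le))
  have hbS : barS b = A := by ext i; simp [barS, b]
  refine ⟨⟨b, hb⟩, ?_⟩
  apply Subtype.ext
  apply Prod.ext
  · exact hbS
  · change (barS b).map b.perm.toEmbedding = B
    rw [hbS]
    apply Finset.eq_of_subset_of_card_le
    · intro x hx
      rw [Finset.mem_map] at hx
      obtain ⟨i, hi, rfl⟩ := hx
      change p i ∈ B
      rw [p1 i hi]
      exact (e1 ⟨i, hi⟩).2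
    · simp [hAB]

theorem mem_Des (hn : 0 < n) {b : SignedPerm n} (hb : AvoidsB b) (i : ℕ) :
    i ∈ DesB b ↔ ∃ h : 1 ≤ i ∧ i ≤ n, b.bar ⟨i - 1, by omega⟩ = true := by
  have key : ∀ h : 1 ≤ i ∧ i < n, (symbKey b ⟨i, h.2⟩ <
            symbKey b ⟨i - 1, Nat.lt_of_le_of_lt (Nat.sub_le i 1) h.2⟩) ↔
            b.bar ⟨i - 1, Nat.lt_of_le_of_lt (Nat.sub_le i 1) h.2⟩ = true := by
    intro h
    have hlt : (⟨i - 1, Nat.lt_of_le_of_lt (Nat.sub_le i 1) h.2⟩ : Fin n) < ⟨i, h.2⟩ := by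
      rw [Fin.lt_def]; simp only; omega
    have h1 := avoid_lt hb hlt
    generalize (⟨i - 1, Nat.lt_of_le_of_lt (Nat.sub_le i 1) h.2⟩ : Fin n) = u at *
    generalize (⟨i, h.2⟩ : Fin n) = v at *
    rw [Fin.lt_def] at h1
    have := (b.perm u).2
    have := (b.perm v).2
    unfold symbKey
    rcases hu : b.bar u <;> rcases hv : b.bar v <;> simp [hu, hv] at h1 ⊢ <;> omega
  constructor
  · rintro (⟨h, h'⟩ | ⟨h, rfl, h'⟩)
    · exact ⟨⟨h.1, h.2.le⟩, (key h).1 h'⟩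
    · exact ⟨⟨h, le_rfl⟩, h'⟩
  · rintro ⟨h, h'⟩
    rcases h.2.eq_or_lt with rfl | h2
    · exact Or.inr ⟨hn, rfl, h'⟩
    · exact Or.inl ⟨⟨h.1, h2⟩, (key ⟨h.1, h2⟩).2 h'⟩

end

end NCB

/-- There is a bijection `φ` from the type-B noncrossing partitions of `[n]`
(ordered by refinement, which for setoids is `≤`) onto the
`(21, 2̄1̄)`-avoiding signed permutations of `[n]`, order-preserving into the
descent-set order: `π ≤ τ → Des (φ π) ⊆ Des (φ τ)`. -/
theorem stmt17 (n : ℕ) (hn : 1 ≤ n) :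
    ∃ φ : {r : Setoid (Fin (2 * n)) // IsNCB r} ≃
          {b : SignedPerm n // AvoidsB b},
      ∀ π τ : {r : Setoid (Fin (2 * n)) // IsNCB r},
        π.1 ≤ τ.1 → DesB (φ π).1 ⊆ DesB (φ τ).1 := by
  let e1 := Equiv.ofBijective _ ⟨NCB.Psi_inj hn, NCB.Psi_surj hn⟩
  let e2 := Equiv.ofBijective _ ⟨NCB.Theta_inj (n := n), NCB.Theta_surj⟩
  refine ⟨e1.trans e2.symm, ?_⟩
  intro π τ h i hi
  have key : ∀ π, NCB.barS ((e1.trans e2.symm) π).1 = NCB.SF hn π.1 := by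
    intro π
    have h1 : e2 ((e1.trans e2.symm) π) = e1 π := by simp
    exact congrArg (fun p : NCB.Pairs n => p.1.1) h1
  rw [NCB.mem_Des hn ((e1.trans e2.symm) τ).2]
  rw [NCB.mem_Des hn ((e1.trans e2.symm) π).2] at hi
  obtain ⟨hin, hb⟩ := hi
  refine ⟨hin, ?_⟩
  have h2 := NCB.SF_mono hn h
  rw [← key, ← key] at h2
  have h3 := @h2 ⟨i - 1, by omega⟩ ((NCB.mem_barS _ _).2 hb)
  exact (NCB.mem_barS _ _).1 h3
end
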